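/- arXiv:1904.01358 — 3 statements merged into one kernel-verified Lean document; each statement's English description precedes it below -/
import Mathlib

section
/- (Littlewood–Richardson rule) For partitions λ and μ, the product of Schur polynomials satisfies s_λ · s_μ = ∑_ν c_{λ,μ}^ν s_ν, where c_{λ,μ}^ν is the number of Yamanouchi semistandard skew tableaux of skew shape ν/λ and content μ. In particular, every structure coefficient of the Schur basis is a nonnegative integer. -/
open MvPolynomial

/-- A partition: a weakly decreasing sequence of nonnegative integers with finite support. -/
def IsPartition (lam : ℕ → ℕ) : Prop :=
  (∀ i j, i ≤ j → lam j ≤ lam i) ∧ ∃ N, ∀ i, N ≤ i → lam i = 0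

/-- Semistandard Young tableaux of shape `lam` with entries in `{1, …, n}`. -/
structure SSYT (lam : ℕ → ℕ) (n : ℕ) where
  entry : ℕ → ℕ → ℕ
  pos : ∀ i j, j < lam i → 1 ≤ entry i j ∧ entry i j ≤ n
  zero : ∀ i j, ¬ j < lam i → entry i j = 0
  rowWeak : ∀ i j j', j ≤ j' → j' < lam i → entry i j ≤ entry i j'
  colStrict : ∀ i i' j, i < i' → j < lam i → j < lam i' → entry i j < entry i' j

/-- The weight of a tableau: `T.wt k` is the number of boxes labelled `k`. -/
noncomputable def SSYT.wt {lam : ℕ → ℕ} {n : ℕ} (T : SSYT lam n) (k : ℕ) : ℕ :=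
  {p : ℕ × ℕ | p.2 < lam p.1 ∧ T.entry p.1 p.2 = k}.ncard

/-- The monomial `x^{wt(T)}`. -/
noncomputable def ssytMonomial {lam : ℕ → ℕ} {n : ℕ} (T : SSYT lam n) :
    MvPolynomial (Fin n) ℤ :=
  ∏ i : Fin n, X i ^ T.wt ((i : ℕ) + 1)

/-- The Schur polynomial in `n` variables: the generating function of semistandard Young
tableaux of shape `lam` with entries in `{1, …, n}`. -/
noncomputable def schurPoly (n : ℕ) (lam : ℕ → ℕ) : MvPolynomial (Fin n) ℤ :=
  ∑ᶠ T : SSYT lam n, ssytMonomial T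

/-- Skew semistandard tableaux of shape `ν/λ`: fillings of the skew diagram by positive
integers, rows weakly increasing, columns strictly increasing. -/
structure SkewSSYT (lam nu : ℕ → ℕ) where
  entry : ℕ → ℕ → ℕ
  pos : ∀ i j, lam i ≤ j → j < nu i → 1 ≤ entry i j
  zero : ∀ i j, ¬ (lam i ≤ j ∧ j < nu i) → entry i j = 0
  rowWeak : ∀ i j j', lam i ≤ j → j ≤ j' → j' < nu i → entry i j ≤ entry i j'
  colStrict : ∀ i i' j, i < i' → lam i ≤ j → j < nu i → lam i' ≤ j → j < nu i' →
    entry i j < entry i' j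

/-- `T` has content `mu`: for each `k`, the number of boxes labelled `k+1` is `mu k`. -/
def SkewSSYT.HasContent {lam nu : ℕ → ℕ} (T : SkewSSYT lam nu) (mu : ℕ → ℕ) : Prop :=
  ∀ k : ℕ,
    {p : ℕ × ℕ | lam p.1 ≤ p.2 ∧ p.2 < nu p.1 ∧ T.entry p.1 p.2 = k + 1}.ncard = mu k

/-- `q` comes weakly before `p` in the reading order (rows top to bottom, each row read
right to left). -/
def readBefore (p q : ℕ × ℕ) : Prop := q.1 < p.1 ∨ (q.1 = p.1 ∧ p.2 ≤ q.2)

/-- `T` is Yamanouchi: every initial segment of its reading word contains at least as many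
`k+1`'s as `k+2`'s, for every `k ≥ 0`. -/
def SkewSSYT.IsYamanouchi {lam nu : ℕ → ℕ} (T : SkewSSYT lam nu) : Prop :=
  ∀ p : ℕ × ℕ, lam p.1 ≤ p.2 → p.2 < nu p.1 → ∀ k : ℕ,
    {q : ℕ × ℕ | lam q.1 ≤ q.2 ∧ q.2 < nu q.1 ∧ readBefore p q ∧
        T.entry q.1 q.2 = k + 2}.ncard ≤
    {q : ℕ × ℕ | lam q.1 ≤ q.2 ∧ q.2 < nu q.1 ∧ readBefore p q ∧
        T.entry q.1 q.2 = k + 1}.ncard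

/-- The Littlewood–Richardson coefficient `c_{λ,μ}^ν`: the number of Yamanouchi
semistandard skew tableaux of shape `ν/λ` and content `μ`. -/
noncomputable def lrCoeff (lam mu nu : ℕ → ℕ) : ℕ :=
  Nat.card {T : SkewSSYT lam nu // T.HasContent mu ∧ T.IsYamanouchi}

namespace LR

/-- Gelfand-Tsetlin patterns: `P i` is the shape formed by the entries `≤ i`. -/
structure IsGT (n : ℕ) (mu : ℕ → ℕ) (P : ℕ → ℕ → ℕ) : Prop where
  zero : ∀ k, P 0 k = 0
  mono : ∀ i k, P i k ≤ P (i+1) k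
  inter : ∀ i k, P (i+1) (k+1) ≤ P i k
  top : ∀ i, n ≤ i → P i = mu

variable {n : ℕ} {mu lam : ℕ → ℕ} {P : ℕ → ℕ → ℕ}

lemma IsGT.vanish (h : IsGT n mu P) : ∀ i k, i ≤ k → P i k = 0 := by
  intro i
  induction i with
  | zero => intro k _; exact h.zero k
  | succ i ih =>
    intro k hk
    obtain ⟨k, rfl⟩ : ∃ k', k = k' + 1 := ⟨k - 1, by omega⟩
    have h1 := h.inter i k
    have h2 := ih k (by omega)
    omega

lemma IsGT.vanish' (h : IsGT n mu P) (i k : ℕ) (hk : n ≤ k) : P i k = 0 := by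
  rcases le_total i n with hi | hi
  · exact h.vanish i k (hi.trans hk)
  · rw [h.top i hi, ← h.top n le_rfl]; exact h.vanish n k hk

lemma IsGT.mono' (h : IsGT n mu P) {i i' : ℕ} (hi : i ≤ i') (k : ℕ) : P i k ≤ P i' k :=
  monotone_nat_of_le_succ (f := fun i => P i k) (fun i => h.mono i k) hi

lemma IsGT.anti (h : IsGT n mu P) (i k : ℕ) : P i (k+1) ≤ P i k :=
  (h.mono i (k+1)).trans (h.inter i k)

lemma IsGT.le_top (h : IsGT n mu P) (i k : ℕ) : P i k ≤ mu k := by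
  rcases le_total i n with hi | hi
  · have := h.mono' hi k; rwa [h.top n le_rfl] at this
  · rw [h.top i hi]

lemma IsGT.mu_le (h : IsGT n mu P) (k : ℕ) : mu k ≤ mu 0 := by
  have : ∀ k, mu (k+1) ≤ mu k := fun k => by
    have := h.anti n k; rwa [h.top n le_rfl] at this
  exact antitone_nat_of_succ_le this (Nat.zero_le k)

lemma finite_GT (n : ℕ) (mu : ℕ → ℕ) : {P | IsGT n mu P}.Finite := by
  let f : (ℕ → ℕ → ℕ) → (Fin n → Fin n → Fin (mu 0 + 1)) := fun P i k => Fin.ofNat _ (P i k)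
  apply Set.Finite.of_finite_image (f := f) (Set.toFinite _)
  intro P hP P' hP' hf
  funext i k
  rcases le_or_gt n k with hk | hk
  · rw [hP.vanish' i k hk, hP'.vanish' i k hk]
  rcases le_or_gt n i with hi | hi
  · rw [hP.top i hi, hP'.top i hi]
  have h := congrFun (congrFun hf ⟨i, hi⟩) ⟨k, hk⟩
  have h := congrArg Fin.val h
  simp only [f, Fin.ofNat] at h
  rwa [Nat.mod_eq_of_lt (by have := hP.le_top i k; have := hP.mu_le k; omega),
    Nat.mod_eq_of_lt (by have := hP'.le_top i k; have := hP'.mu_le k; omega)] at h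

/-- The finite set of patterns with top row `mu`. -/
noncomputable def GT (n : ℕ) (mu : ℕ → ℕ) : Finset (ℕ → ℕ → ℕ) := (finite_GT n mu).toFinset

lemma mem_GT : P ∈ GT n mu ↔ IsGT n mu P := by simp [GT]

/-- Size of level `i`. -/
def W (n : ℕ) (P : ℕ → ℕ → ℕ) (i : ℕ) : ℕ := ∑ k ∈ Finset.range (n+1), P i k

/-- Weight. -/
def wt (n : ℕ) (P : ℕ → ℕ → ℕ) (i : ℕ) : ℕ := W n P (i+1) - W n P i

lemma IsGT.W_mono (h : IsGT n mu P) (i : ℕ) : W n P i ≤ W n P (i+1) :=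
  Finset.sum_le_sum fun k _ => h.mono i k

/-- Schur polynomial via patterns. -/
noncomputable def S (n : ℕ) (mu : ℕ → ℕ) : MvPolynomial (Fin n) ℤ :=
  ∑ P ∈ GT n mu, ∏ i : Fin n, X i ^ wt n P i

lemma S_eq_zero (h : mu n ≠ 0) : S n mu = 0 := by
  apply Finset.sum_eq_zero
  intro P hP
  rw [mem_GT] at hP
  exact absurd (by rw [← hP.top n le_rfl]; exact hP.vanish n n le_rfl) h

lemma IsGT.update (h : IsGT n mu P) {i : ℕ} (hi : i + 1 < n) (b : ℕ → ℕ)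
    (h1 : ∀ l, P i l ≤ b l) (h2 : ∀ l, P (i+2) (l+1) ≤ b l)
    (h3 : ∀ l, b l ≤ P (i+2) l) (h4 : ∀ l, b (l+1) ≤ P i l) :
    IsGT n mu (Function.update P (i+1) b) := by
  constructor
  · intro k; rw [Function.update_of_ne (by omega)]; exact h.zero k
  · intro j k
    by_cases e1 : j = i
    · subst e1; rw [Function.update_of_ne (by omega), Function.update_self]; exact h1 k
    by_cases e2 : j = i + 1
    · subst e2; rw [Function.update_self, Function.update_of_ne (by omega)]; exact h3 k
    rw [Function.update_of_ne (by omega), Function.update_of_ne (by omega)]; exact h.mono j k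
  · intro j k
    by_cases e1 : j = i
    · subst e1; rw [Function.update_self, Function.update_of_ne (by omega)]; exact h4 k
    by_cases e2 : j = i + 1
    · subst e2; rw [Function.update_of_ne (by omega), Function.update_self]; exact h2 k
    rw [Function.update_of_ne (by omega), Function.update_of_ne (by omega)]; exact h.inter j k
  · intro j hj; rw [Function.update_of_ne (by omega)]; exact h.top j hj

/-- lower end of the interval for entry `l` of level `i+1` -/
def lo (P : ℕ → ℕ → ℕ) (i l : ℕ) : ℕ := max (P i l) (P (i+2) (l+1))
/-- upper end of the interval -/
def hi (P : ℕ → ℕ → ℕ) (i : ℕ) : ℕ → ℕ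
  | 0 => P (i+2) 0
  | l+1 => min (P i l) (P (i+2) (l+1))

lemma lo_add_hi (P : ℕ → ℕ → ℕ) (i l : ℕ) : lo P i l + hi P i (l+1) = P i l + P (i+2) (l+1) := by
  simp only [lo, hi]; omega

lemma IsGT.lo_le (h : IsGT n mu P) (i l : ℕ) : lo P i l ≤ P (i+1) l :=
  max_le (h.mono i l) (h.inter (i+1) l)

lemma IsGT.le_hi (h : IsGT n mu P) (i l : ℕ) : P (i+1) l ≤ hi P i l := by
  cases l with
  | zero => exact h.mono (i+1) 0
  | succ l => exact le_min (h.inter i l) (h.mono (i+1) (l+1))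

lemma IsGT.update' (h : IsGT n mu P) {i : ℕ} (hi' : i + 1 < n) (b : ℕ → ℕ)
    (h1 : ∀ l, lo P i l ≤ b l) (h2 : ∀ l, b l ≤ hi P i l) :
    IsGT n mu (Function.update P (i+1) b) := by
  apply h.update hi'
  · intro l; exact (le_max_left _ _).trans (h1 l)
  · intro l; exact (le_max_right _ _).trans (h1 l)
  · intro l
    cases l with
    | zero => exact h2 0
    | succ l => exact (h2 (l+1)).trans (min_le_right _ _)
  · intro l; exact (h2 (l+1)).trans (min_le_left _ _)

lemma lo_update (P : ℕ → ℕ → ℕ) (i : ℕ) (b) : lo (Function.update P (i+1) b) i = lo P i := by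
  funext l; simp [lo]
lemma hi_update (P : ℕ → ℕ → ℕ) (i : ℕ) (b) : hi (Function.update P (i+1) b) i = hi P i := by
  funext l; cases l <;> simp [hi]

lemma W_update_ne (P : ℕ → ℕ → ℕ) (i j : ℕ) (b) (hj : j ≠ i) :
    W n (Function.update P i b) j = W n P j := by simp [W, hj]
lemma W_update_self (P : ℕ → ℕ → ℕ) (i : ℕ) (b) :
    W n (Function.update P i b) i = ∑ l ∈ Finset.range (n+1), b l := by simp [W]

/-- Bender-Knuth reflection of level `i+1`. -/
def refl (i : ℕ) (P : ℕ → ℕ → ℕ) : ℕ → ℕ → ℕ :=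
  Function.update P (i+1) fun l => lo P i l + hi P i l - P (i+1) l

lemma IsGT.refl (h : IsGT n mu P) {i : ℕ} (hi' : i + 1 < n) : IsGT n mu (refl i P) := by
  apply h.update' hi'
  · intro l; have := h.le_hi i l; omega
  · intro l; have := h.lo_le i l; omega

lemma IsGT.refl_refl (h : IsGT n mu P) (i : ℕ) : LR.refl i (LR.refl i P) = P := by
  unfold LR.refl
  rw [lo_update, hi_update, Function.update_idem]
  conv_rhs => rw [← Function.update_eq_self (i+1) P]
  congr 1
  funext l
  have := h.le_hi i l
  have := h.lo_le i l
  simp; omega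

/-- telescoping sum -/
lemma tele (P : ℕ → ℕ → ℕ) (i k : ℕ) (b : ℕ → ℕ) (c d : ℕ)
    (hb : ∀ l, k < l → b l + P (i+1) l = lo P i l + hi P i l)
    (h0 : ∑ l ∈ Finset.range (k+1), b l + ∑ l ∈ Finset.range (k+1), P (i+1) l + c =
      ∑ l ∈ Finset.range k, P i l + ∑ l ∈ Finset.range (k+1), P (i+2) l + lo P i k + d) :
    ∀ N, k ≤ N →
    ∑ l ∈ Finset.range (N+1), b l + ∑ l ∈ Finset.range (N+1), P (i+1) l + c =
      ∑ l ∈ Finset.range N, P i l + ∑ l ∈ Finset.range (N+1), P (i+2) l + lo P i N + d := by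
  intro N hN
  induction N, hN using Nat.le_induction with
  | base => exact h0
  | succ N hN ih =>
    have h1 := hb (N+1) (by omega)
    have h2 := lo_add_hi P i N
    rw [Finset.sum_range_succ b (N+1), Finset.sum_range_succ (P (i+1)) (N+1),
      Finset.sum_range_succ (P i) N, Finset.sum_range_succ (P (i+2)) (N+1)]
    omega

lemma IsGT.tele_W (h : IsGT n mu P) (i k : ℕ) (b : ℕ → ℕ) (c d : ℕ) (hk : k ≤ n)
    (hb : ∀ l, k < l → b l + P (i+1) l = lo P i l + hi P i l)
    (h0 : ∑ l ∈ Finset.range (k+1), b l + ∑ l ∈ Finset.range (k+1), P (i+1) l + c =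
      ∑ l ∈ Finset.range k, P i l + ∑ l ∈ Finset.range (k+1), P (i+2) l + lo P i k + d) :
    W n (Function.update P (i+1) b) (i+1) + W n P (i+1) + c = W n P i + W n P (i+2) + d := by
  have := tele P i k b c d hb h0 n hk
  have e1 : lo P i n = 0 := by
    simp [lo, h.vanish' i n le_rfl, h.vanish' (i+2) (n+1) (by omega)]
  rw [W_update_self, W, W, W, this, e1, Finset.sum_range_succ (P i) n, h.vanish' i n le_rfl]
  ring

lemma IsGT.W_refl (h : IsGT n mu P) (i : ℕ) :
    W n (LR.refl i P) (i+1) + W n P (i+1) = W n P i + W n P (i+2) := by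
  have := h.tele_W i 0 (fun l => lo P i l + hi P i l - P (i+1) l) 0 0 (by omega)
    (fun l _ => by have := h.le_hi i l; have := h.lo_le i l; omega)
    (by have := h.le_hi i 0; have := h.lo_le i 0; simp [hi] at *; omega)
  unfold LR.refl
  simpa using this

lemma S_swap (m : ℕ) (mu : ℕ → ℕ) (i : Fin m) :
    rename (Equiv.swap i.castSucc i.succ) (S (m+1) mu) = S (m+1) mu := by
  rw [S, map_sum]
  have hi' : (i : ℕ) + 1 < m + 1 := by omega
  apply Finset.sum_nbij' (fun P => refl i P) (fun P => refl i P)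
  · intro P hP; rw [mem_GT] at *; exact hP.refl hi'
  · intro P hP; rw [mem_GT] at *; exact hP.refl hi'
  · intro P hP; rw [mem_GT] at *; exact hP.refl_refl i
  · intro P hP; rw [mem_GT] at *; exact hP.refl_refl i
  · intro P hP
    rw [mem_GT] at hP
    have hP' := hP.refl hi'
    have hW : W (m+1) (refl i P) (i+1) + W (m+1) P (i+1) = W (m+1) P i + W (m+1) P (i+1+1) :=
      hP.W_refl i
    simp only [map_prod, map_pow, rename_X]
    rw [← Equiv.prod_comp (Equiv.swap i.castSucc i.succ)]
    apply Finset.prod_congr rfl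
    intro j _
    rw [Equiv.swap_apply_self]
    congr 1
    have a1 := hP.W_mono i
    have a2 := hP.W_mono (i+1)
    have b1 := hP'.W_mono i
    have b2 := hP'.W_mono (i+1)
    have c1 : W (m+1) (refl i P) i = W (m+1) P i := W_update_ne _ _ _ _ (by omega)
    have c2 : W (m+1) (refl i P) (i+1+1) = W (m+1) P (i+1+1) := W_update_ne _ _ _ _ (by omega)
    by_cases e1 : j = i.castSucc
    · subst e1
      rw [Equiv.swap_apply_left]
      simp only [wt, Fin.val_succ, Fin.val_castSucc]
      omega
    by_cases e2 : j = i.succ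
    · subst e2
      rw [Equiv.swap_apply_right]
      simp only [wt, Fin.val_succ, Fin.val_castSucc]
      omega
    rw [Equiv.swap_apply_of_ne_of_ne e1 e2]
    have e1' : (j : ℕ) ≠ i := fun h => e1 (Fin.ext (by simpa using h))
    have e2' : (j : ℕ) ≠ i + 1 := fun h => e2 (Fin.ext (by simpa using h))
    have d1 : W (m+1) (refl i P) j = W (m+1) P j := W_update_ne _ _ _ _ (by omega)
    have d2 : W (m+1) (refl i P) (j+1) = W (m+1) P (j+1) := W_update_ne _ _ _ _ (by omega)
    simp only [wt, d1, d2]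

lemma S_symm (n : ℕ) (mu : ℕ → ℕ) (σ : Equiv.Perm (Fin n)) : rename σ (S n mu) = S n mu := by
  cases n with
  | zero =>
    have : σ = 1 := Subsingleton.elim _ _
    subst this
    simp
  | succ m =>
    have hσ : σ ∈ Submonoid.closure (Set.range fun i : Fin m ↦ Equiv.swap i.castSucc i.succ) := by
      rw [Equiv.Perm.mclosure_swap_castSucc_succ]; trivial
    induction hσ using Submonoid.closure_induction with
    | mem x hx => obtain ⟨i, rfl⟩ := hx; exact S_swap m mu i
    | one => simp
    | mul x y _ _ hx hy =>
      have : rename (R := ℤ) (⇑(x * y)) (S (m+1) mu) = rename x (rename y (S (m+1) mu)) := by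
        rw [rename_rename]; rfl
      rw [this, hy, hx]

/-- alternants -/
noncomputable def alt (n : ℕ) (v : ℕ → ℕ) : MvPolynomial (Fin n) ℤ :=
  Matrix.det (Matrix.of fun i j : Fin n => (X i : MvPolynomial (Fin n) ℤ) ^ v j)

lemma alt_mul_S (v : ℕ → ℕ) :
    alt n v * S n mu = ∑ P ∈ GT n mu, alt n (fun i => v i + wt n P i) := by
  simp only [alt, Matrix.det_apply, Finset.sum_mul]
  rw [Finset.sum_comm]
  apply Finset.sum_congr rfl
  intro σ _
  rw [← S_symm n mu σ, S, map_sum, smul_mul_assoc, Finset.mul_sum, Finset.smul_sum]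
  apply Finset.sum_congr rfl
  intro P _
  simp only [map_prod, map_pow, rename_X, ← Finset.prod_mul_distrib, Matrix.of_apply, pow_add]

lemma alt_swap (v w : ℕ → ℕ) (i : ℕ) (hi : i + 1 < n) (h1 : w i = v (i+1)) (h2 : w (i+1) = v i)
    (h3 : ∀ j, j ≠ i → j ≠ i+1 → w j = v j) : alt n v + alt n w = 0 := by
  let a : Fin n := ⟨i, by omega⟩
  let b : Fin n := ⟨i+1, hi⟩
  have hab : a ≠ b := by simp [a, b]
  have := Matrix.det_permute' (Equiv.swap a b)
    (Matrix.of fun i j : Fin n => (X i : MvPolynomial (Fin n) ℤ) ^ v j)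
  rw [Equiv.Perm.sign_swap hab] at this
  have e : alt n w = -alt n v := by
    rw [alt, alt]
    simp only [Units.val_neg, Units.val_one, Int.cast_neg, Int.cast_one, neg_mul, one_mul] at this
    rw [← this]
    congr 1
    ext1 p q
    simp only [Matrix.of_apply, Matrix.submatrix_apply, id]
    congr 1
    by_cases e1 : q = a
    · subst e1; rw [Equiv.swap_apply_left]; exact h1
    by_cases e2 : q = b
    · subst e2; rw [Equiv.swap_apply_right]; exact h2
    rw [Equiv.swap_apply_of_ne_of_ne e1 e2]
    exact h3 q (fun h => e1 (Fin.ext h)) (fun h => e2 (Fin.ext h))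
  rw [e]; ring

lemma alt_rho_ne : alt n (fun i => n - 1 - i) ≠ 0 := by
  have := Matrix.det_permute' (Fin.revPerm)
    (Matrix.of fun i j : Fin n => (X i : MvPolynomial (Fin n) ℤ) ^ (n - 1 - (j : ℕ)))
  intro h0
  rw [alt] at h0
  rw [h0, mul_zero] at this
  have hv : Matrix.det (Matrix.vandermonde fun i : Fin n => (X i : MvPolynomial (Fin n) ℤ)) = 0 := by
    rw [← this]
    congr 1
    ext1 p q
    simp only [Matrix.vandermonde_apply, Matrix.of_apply, Matrix.submatrix_apply, id]
    congr 1
    simp [Fin.val_rev]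
    omega
  exact Matrix.det_vandermonde_ne_zero_iff.mpr (X_injective) hv

/-- The `lam`-goodness condition at letters `i, i+1` and row `k`. -/
def G (lam : ℕ → ℕ) (P : ℕ → ℕ → ℕ) (i k : ℕ) : Prop :=
  lam (i+1) + ∑ l ∈ Finset.range (k+1), P (i+2) l + ∑ l ∈ Finset.range k, P i l ≤
    lam i + ∑ l ∈ Finset.range (k+1), P (i+1) l + ∑ l ∈ Finset.range k, P (i+1) l

/-- Good patterns. -/
def Good (n : ℕ) (lam : ℕ → ℕ) (P : ℕ → ℕ → ℕ) : Prop := ∀ i k, i + 1 < n → G lam P i k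

/-- The first bad position in reading order. -/
def FB (n : ℕ) (lam : ℕ → ℕ) (P : ℕ → ℕ → ℕ) (i k : ℕ) : Prop :=
  i + 1 < n ∧ ¬ G lam P i k ∧ (∀ k' < k, ∀ i', i' + 1 < n → G lam P i' k') ∧
    ∀ i', i < i' → i' + 1 < n → G lam P i' k

lemma FB.unique {i k i' k' : ℕ} (h : FB n lam P i k) (h' : FB n lam P i' k') :
    i = i' ∧ k = k' := by
  have hk : k = k' := by
    rcases lt_trichotomy k k' with e | e | e
    · exact absurd (h'.2.2.1 k e i h.1) h.2.1
    · exact e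
    · exact absurd (h.2.2.1 k' e i' h'.1) h'.2.1
  subst hk
  refine ⟨?_, rfl⟩
  rcases lt_trichotomy i i' with e | e | e
  · exact absurd (h.2.2.2 i' e h'.1) h'.2.1
  · exact e
  · exact absurd (h'.2.2.2 i e h.1) h.2.1

open Classical in
lemma exists_FB (h : ¬ Good n lam P) : ∃ p : ℕ × ℕ, FB n lam P p.1 p.2 := by
  have h1 : ∃ k, ∃ i, i + 1 < n ∧ ¬ G lam P i k := by
    unfold Good at h; push Not at h
    obtain ⟨i, k, a, b⟩ := h
    exact ⟨k, i, a, b⟩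
  let k := Nat.find h1
  have hk : ∃ i, i + 1 < n ∧ ¬ G lam P i k := Nat.find_spec h1
  have hk' : ∀ k' < k, ∀ i', i' + 1 < n → G lam P i' k' := by
    intro k' hk' i' hi'
    by_contra hc
    exact Nat.find_min h1 hk' ⟨i', hi', hc⟩
  let s := (Finset.range n).filter fun i => i + 1 < n ∧ ¬ G lam P i k
  have hs : s.Nonempty := by
    obtain ⟨i, a, b⟩ := hk
    exact ⟨i, by simp [s, a, b]; omega⟩
  have hm := Finset.max'_mem s hs
  refine ⟨(s.max' hs, k), ?_⟩
  simp only [s, Finset.mem_filter] at hm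
  refine ⟨hm.2.1, hm.2.2, hk', ?_⟩
  intro i' h1 h2
  by_contra hc
  have : i' ∈ s := by simp [s, h2, hc]; omega
  exact absurd (Finset.le_max' s i' this) (not_le.mpr h1)

/-- New level in the sign reversing involution. -/
def flipB (lam : ℕ → ℕ) (P : ℕ → ℕ → ℕ) (i k l : ℕ) : ℕ :=
  if l < k then P (i+1) l else if l = k then
    (lam (i+1) + ∑ l ∈ Finset.range (k+1), P (i+2) l + ∑ l ∈ Finset.range k, P i l + lo P i k)
      - (1 + lam i + ∑ l ∈ Finset.range (k+1), P (i+1) l + ∑ l ∈ Finset.range k, P (i+1) l)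
  else lo P i l + hi P i l - P (i+1) l

/-- The sign reversing involution. -/
def flip (lam : ℕ → ℕ) (i k : ℕ) (P : ℕ → ℕ → ℕ) : ℕ → ℕ → ℕ :=
  Function.update P (i+1) (flipB lam P i k)

lemma flipB_lt {i k l : ℕ} (h : l < k) : flipB lam P i k l = P (i+1) l := by simp [flipB, h]

lemma flipB_gt {i k l : ℕ} (h : k < l) :
    flipB lam P i k l = lo P i l + hi P i l - P (i+1) l := by
  simp [flipB, not_lt.mpr h.le, h.ne']

lemma sum_flipB {i k : ℕ} (l : ℕ) (h : l ≤ k) :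
    ∑ l ∈ Finset.range l, flipB lam P i k l = ∑ l ∈ Finset.range l, P (i+1) l := by
  apply Finset.sum_congr rfl
  intro x hx
  rw [Finset.mem_range] at hx
  exact flipB_lt (by omega)

lemma flipB_self {i k : ℕ} (hb : ¬ G lam P i k) :
    flipB lam P i k k + (1 + lam i + ∑ l ∈ Finset.range (k+1), P (i+1) l
      + ∑ l ∈ Finset.range k, P (i+1) l) =
    lam (i+1) + ∑ l ∈ Finset.range (k+1), P (i+2) l + ∑ l ∈ Finset.range k, P i l + lo P i k := by
  unfold G at hb
  simp only [flipB, lt_irrefl, if_true, if_false]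
  omega

lemma FB.k_le {i k : ℕ} (hP : IsGT n mu P) (h : FB n lam P i k) : k ≤ n := by
  by_contra hk
  obtain ⟨m, rfl⟩ : ∃ m, k = m + 1 := ⟨k - 1, by omega⟩
  have h1 := h.2.2.1 m (by omega) i h.1
  apply h.2.1
  unfold G at *
  have e1 := hP.vanish' (i+2) (m+1) (by omega)
  have e2 := hP.vanish' i m (by omega)
  rw [Finset.sum_range_succ _ (m+1), Finset.sum_range_succ (P i) m,
    Finset.sum_range_succ (P (i+1)) (m+1)]
  have := Finset.sum_range_succ (P (i+1)) m
  omega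

lemma FB.flip_GT {i k : ℕ} (hlam : ∀ i, lam (i+1) ≤ lam i) (hP : IsGT n mu P)
    (h : FB n lam P i k) : IsGT n mu (flip lam i k P) := by
  have hs := flipB_self h.2.1
  have hb := h.2.1
  unfold G at hb
  apply hP.update' h.1
  · intro l
    rcases lt_trichotomy l k with e | e | e
    · rw [flipB_lt e]; exact hP.lo_le i l
    · subst e; omega
    · rw [flipB_gt e]; have := hP.le_hi i l; omega
  · intro l
    rcases lt_trichotomy l k with e | e | e
    · rw [flipB_lt e]; exact hP.le_hi i l
    · subst e
      have h1 := hP.lo_le i l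
      cases l with
      | zero =>
        have := hlam i
        simp [hi] at *
        omega
      | succ m =>
        have h2 := h.2.2.1 m (by omega) i h.1
        unfold G at h2
        have h3 := hP.lo_le i m
        have h4 := lo_add_hi P i m
        rw [Finset.sum_range_succ (P (i+2)) (m+1), Finset.sum_range_succ (P i) m,
          Finset.sum_range_succ (P (i+1)) (m+1)] at hs
        have := Finset.sum_range_succ (P (i+1)) m
        omega
    · rw [flipB_gt e]; have := hP.lo_le i l; omega

lemma FB.W_flip {i k : ℕ} (hP : IsGT n mu P) (h : FB n lam P i k) :
    W n (flip lam i k P) (i+1) + W n P (i+1) + (lam i + 1) =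
      W n P i + W n P (i+2) + lam (i+1) := by
  apply hP.tele_W i k _ _ _ (h.k_le hP)
  · intro l hl
    rw [flipB_gt hl]
    have := hP.lo_le i l
    have := hP.le_hi i l
    omega
  · have := flipB_self h.2.1
    rw [Finset.sum_range_succ (flipB _ _ _ _), sum_flipB k le_rfl]
    omega

lemma G_congr {P P' : ℕ → ℕ → ℕ} {i k : ℕ} (h1 : ∀ l < k + 1, P (i+2) l = P' (i+2) l)
    (h2 : ∀ l < k + 1, P (i+1) l = P' (i+1) l) (h3 : ∀ l < k, P i l = P' i l) :
    G lam P i k ↔ G lam P' i k := by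
  unfold G
  rw [Finset.sum_congr rfl fun l hl => h1 l (Finset.mem_range.mp hl),
    Finset.sum_congr (f := P (i+1)) (s₁ := Finset.range (k+1)) rfl
      fun l hl => h2 l (Finset.mem_range.mp hl),
    Finset.sum_congr (f := P (i+1)) (s₁ := Finset.range k) rfl
      fun l hl => h2 l (by have := Finset.mem_range.mp hl; omega),
    Finset.sum_congr (f := P i) rfl fun l hl => h3 l (Finset.mem_range.mp hl)]

lemma flip_lt {i k l : ℕ} (j : ℕ) (h : l < k) : flip lam i k P j l = P j l := by
  unfold flip
  by_cases e : j = i + 1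
  · subst e; rw [Function.update_self, flipB_lt h]
  · rw [Function.update_of_ne e]

lemma flip_ne {i k j : ℕ} (l : ℕ) (h : j ≠ i + 1) : flip lam i k P j l = P j l := by
  unfold flip
  rw [Function.update_of_ne h]

lemma FB.flip_FB {i k : ℕ} (hP : IsGT n mu P) (h : FB n lam P i k) :
    FB n lam (flip lam i k P) i k := by
  refine ⟨h.1, ?_, ?_, ?_⟩
  · have hs := flipB_self h.2.1
    have hb := h.2.1
    unfold G at *
    have h1 := hP.lo_le i k
    have e1 : flip lam i k P (i+2) = P (i+2) := funext fun l => flip_ne l (by omega)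
    have e2 : flip lam i k P i = P i := funext fun l => flip_ne l (by omega)
    have e3 : flip lam i k P (i+1) = flipB lam P i k := by simp [flip]
    rw [e1, e2, e3, Finset.sum_range_succ (flipB _ _ _ _), sum_flipB k le_rfl]
    rw [Finset.sum_range_succ (P (i+1))] at hs
    omega
  · intro k' hk' i' hi'
    rw [G_congr (P' := P)]
    · exact h.2.2.1 k' hk' i' hi'
    all_goals intro l hl; exact flip_lt _ (by omega)
  · intro i' h1 h2
    rw [G_congr (P' := P)]
    · exact h.2.2.2 i' h1 h2
    · intro l hl; exact flip_ne _ (by omega)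
    · intro l hl; exact flip_ne _ (by omega)
    · intro l hl; exact flip_lt _ (by omega)

lemma FB.flip_flip {i k : ℕ} (hP : IsGT n mu P) (h : FB n lam P i k) :
    flip lam i k (flip lam i k P) = P := by
  have h' := h.flip_FB hP
  have hs := flipB_self h.2.1
  have hs' := flipB_self h'.2.1
  have e1 : flip lam i k P (i+2) = P (i+2) := funext fun l => flip_ne l (by omega)
  have e2 : flip lam i k P i = P i := funext fun l => flip_ne l (by omega)
  have e3 : flip lam i k P (i+1) = flipB lam P i k := by simp [flip]
  have e4 : lo (flip lam i k P) i = lo P i := lo_update _ _ _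
  have e5 : hi (flip lam i k P) i = hi P i := hi_update _ _ _
  funext j l
  by_cases ej : j = i + 1
  · subst ej
    conv_lhs => rw [LR.flip, Function.update_self]
    rcases lt_trichotomy l k with e | e | e
    · rw [flipB_lt e, flip_lt _ e]
    · subst e
      rw [e1, e2, e3, e4, Finset.sum_range_succ (flipB _ _ _ _), sum_flipB l le_rfl] at hs'
      rw [Finset.sum_range_succ (P (i+1))] at hs
      omega
    · rw [flipB_gt e, e3, e4, e5, flipB_gt e]
      have := hP.lo_le i l
      have := hP.le_hi i l
      omega
  · rw [flip_ne _ ej, flip_ne _ ej]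

open Classical in
/-- Location of the first bad position. -/
noncomputable def loc (n : ℕ) (lam : ℕ → ℕ) (P : ℕ → ℕ → ℕ) : ℕ × ℕ :=
  if h : ¬ Good n lam P then (exists_FB h).choose else (0, 0)

lemma loc_FB (h : ¬ Good n lam P) : FB n lam P (loc n lam P).1 (loc n lam P).2 := by
  rw [loc, dif_pos h]; exact (exists_FB h).choose_spec

lemma FB.not_good {i k : ℕ} (h : FB n lam P i k) : ¬ Good n lam P := fun hg => h.2.1 (hg i k h.1)

lemma FB.loc_eq {i k : ℕ} (h : FB n lam P i k) : loc n lam P = (i, k) := by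
  have := (loc_FB h.not_good).unique h
  exact Prod.ext this.1 this.2

lemma FB.alt_cancel {i k : ℕ} (hlam : ∀ i, lam (i+1) ≤ lam i) (hP : IsGT n mu P)
    (h : FB n lam P i k) :
    alt n (fun j => lam j + (n - 1 - j) + wt n P j) +
      alt n (fun j => lam j + (n - 1 - j) + wt n (flip lam i k P) j) = 0 := by
  have hP' := h.flip_GT hlam hP
  have hW : W n (flip lam i k P) (i+1) + W n P (i+1) + (lam i + 1) =
      W n P i + W n P (i+1+1) + lam (i+1) := h.W_flip hP
  have hi := h.1
  have a1 := hP.W_mono i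
  have a2 := hP.W_mono (i+1)
  have b1 := hP'.W_mono i
  have b2 := hP'.W_mono (i+1)
  have c : ∀ j, j ≠ i + 1 → W n (flip lam i k P) j = W n P j := fun j hj =>
    W_update_ne _ _ _ _ hj
  have c1 := c i (by omega)
  have c2 := c (i+1+1) (by omega)
  apply alt_swap _ _ i h.1
  · simp only [wt]; omega
  · simp only [wt]; omega
  · intro j h1 h2
    simp only [wt]
    rw [c j h2, c (j+1) (by omega)]

open Classical in
lemma alt_mul_good (hlam : ∀ i, lam (i+1) ≤ lam i) :
    alt n (fun j => lam j + (n - 1 - j)) * S n mu =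
      ∑ P ∈ (GT n mu).filter (Good n lam), alt n (fun j => lam j + (n - 1 - j) + wt n P j) := by
  rw [alt_mul_S, ← Finset.sum_filter_add_sum_filter_not (GT n mu) (Good n lam)]
  conv_rhs => rw [← add_zero (Finset.sum _ _)]
  congr 1
  apply Finset.sum_involution (fun P _ => flip lam (loc n lam P).1 (loc n lam P).2 P)
  · intro P hP
    rw [Finset.mem_filter, mem_GT] at hP
    exact (loc_FB hP.2).alt_cancel hlam hP.1
  · intro P hP hne heq
    rw [Finset.mem_filter, mem_GT] at hP
    have := (loc_FB hP.2).alt_cancel hlam hP.1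
    rw [heq] at this
    apply hne
    exact self_eq_neg.mp (eq_neg_of_add_eq_zero_left this)
  · intro P hP
    rw [Finset.mem_filter, mem_GT] at hP ⊢
    exact ⟨(loc_FB hP.2).flip_GT hlam hP.1, ((loc_FB hP.2).flip_FB hP.1).not_good⟩
  · intro P hP
    rw [Finset.mem_filter, mem_GT] at hP
    rw [((loc_FB hP.2).flip_FB hP.1).loc_eq]
    exact (loc_FB hP.2).flip_flip hP.1

/-! The case `lam = 0`. -/

lemma good_zero_step (hg : Good n (fun _ => 0) P) (h : IsGT n mu P) :
    ∀ k i, k < i → i < n → P i k = P (i+1) k := by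
  intro k
  induction k using Nat.strong_induction_on with
  | _ k ih =>
    intro i hk hi
    obtain ⟨j, rfl⟩ : ∃ j, i = j + 1 := ⟨i - 1, by omega⟩
    have h1 := hg j k hi
    unfold G at h1
    beta_reduce at h1
    have e1 : ∑ l ∈ Finset.range k, P (j+2) l = ∑ l ∈ Finset.range k, P (j+1) l :=
      Finset.sum_congr rfl fun l hl => by
        rw [Finset.mem_range] at hl
        exact (ih l hl (j+1) (by omega) hi).symm
    have e2 : ∑ l ∈ Finset.range k, P j l = ∑ l ∈ Finset.range k, P (j+1) l :=
      Finset.sum_congr rfl fun l hl => by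
        rw [Finset.mem_range] at hl
        exact (ih l hl j (by omega) (by omega))
    rw [Finset.sum_range_succ, Finset.sum_range_succ, e1, e2] at h1
    have : P (j+1) k ≤ P (j+1+1) k := h.mono (j+1) k
    have e : P (j+2) k = P (j+1+1) k := rfl
    omega

/-- The superstandard pattern. -/
def sup (mu : ℕ → ℕ) (i k : ℕ) : ℕ := if k < i then mu k else 0

lemma good_zero_eq (hg : Good n (fun _ => 0) P) (h : IsGT n mu P) : P = sup mu := by
  have key : ∀ d i k, k < i → i + d = n → P i k = mu k := by
    intro d
    induction d with
    | zero => intro i k _ hi; rw [h.top i (by omega)]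
    | succ d ih =>
      intro i k hk hi
      rw [good_zero_step hg h k i hk (by omega)]
      exact ih (i+1) k (by omega) (by omega)
  funext i k
  unfold sup
  split_ifs with hk
  · rcases le_total i n with hi | hi
    · exact key (n - i) i k hk (by omega)
    · rw [h.top i hi]
  · exact h.vanish i k (by omega)

lemma sum_sup (N i : ℕ) :
    ∑ l ∈ Finset.range N, sup mu i l = ∑ l ∈ Finset.range (min N i), mu l := by
  induction N with
  | zero => simp
  | succ N ih =>
    rw [Finset.sum_range_succ, ih, sup]
    split_ifs with h
    · rw [min_eq_left h.le, min_eq_left (by omega), Finset.sum_range_succ]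
    · rw [min_eq_right (by omega), min_eq_right (by omega), add_zero]

lemma sup_GT (hmu : ∀ i, mu (i+1) ≤ mu i) (h0 : mu n = 0) : IsGT n mu (sup mu) := by
  have hz : ∀ k, n ≤ k → mu k = 0 := fun k hk => by
    have := antitone_nat_of_succ_le hmu hk; omega
  constructor
  · intro k; simp [sup]
  · intro i k; unfold sup; split_ifs <;> omega
  · intro i k; have := hmu k; unfold sup; split_ifs <;> omega
  · intro i hi; funext k; unfold sup; split_ifs with h
    · rfl
    · exact (hz k (by omega)).symm

lemma sup_good (hmu : ∀ i, mu (i+1) ≤ mu i) : Good n (fun _ => 0) (sup mu) := by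
  intro i k _
  unfold G
  simp only [sum_sup]
  rcases le_or_gt k i with h | h
  · rw [min_eq_left (by omega : k + 1 ≤ i + 2), min_eq_left h,
      min_eq_left (by omega : k + 1 ≤ i + 1), min_eq_left (by omega : k ≤ i + 1)]
  · rw [min_eq_right (by omega : i + 2 ≤ k + 1), min_eq_right (by omega : i ≤ k),
      min_eq_right (by omega : i + 1 ≤ k + 1), min_eq_right (by omega : i + 1 ≤ k)]
    rw [Finset.sum_range_succ _ (i+1), Finset.sum_range_succ _ i]
    have := hmu i
    omega

lemma wt_sup (i : ℕ) (hi : i < n) : wt n (sup mu) i = mu i := by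
  unfold wt W
  rw [sum_sup, sum_sup, min_eq_right (by omega), min_eq_right (by omega), Finset.sum_range_succ]
  omega

lemma alt_congr {v w : ℕ → ℕ} (h : ∀ i < n, v i = w i) : alt n v = alt n w := by
  unfold alt
  congr 1
  ext1 i j
  simp only [Matrix.of_apply, h j j.2]

lemma alt_rho_mul_S (hmu : ∀ i, mu (i+1) ≤ mu i) (h0 : mu n = 0) :
    alt n (fun j => n - 1 - j) * S n mu = alt n (fun j => mu j + (n - 1 - j)) := by
  classical
  have h := alt_mul_good (n := n) (mu := mu) (lam := fun _ => 0) (fun _ => le_rfl)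
  have e : (GT n mu).filter (Good n fun _ => 0) = {sup mu} := by
    ext P
    rw [Finset.mem_filter, mem_GT, Finset.mem_singleton]
    constructor
    · rintro ⟨h1, h2⟩; exact good_zero_eq h2 h1
    · rintro rfl; exact ⟨sup_GT hmu h0, sup_good hmu⟩
  rw [e, Finset.sum_singleton] at h
  simp only [zero_add] at h
  rw [h]
  apply alt_congr
  intro i hi
  rw [wt_sup i hi, add_comm]

/-- The resulting shape. -/
def sh (n : ℕ) (lam : ℕ → ℕ) (P : ℕ → ℕ → ℕ) (i : ℕ) : ℕ := lam i + wt n P i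

lemma IsGT.wt_zero (h : IsGT n mu P) (i : ℕ) (hi : n ≤ i) : wt n P i = 0 := by
  simp [wt, W, h.top i hi, h.top (i+1) (by omega)]

lemma sh_anti (hlam : ∀ i, lam (i+1) ≤ lam i) (h : IsGT n mu P)
    (hg : Good n lam P) (i : ℕ) : sh n lam P (i+1) ≤ sh n lam P i := by
  unfold sh
  rcases lt_or_ge (i+1) n with hi | hi
  · have := hg i n hi
    unfold G at this
    have z : ∀ j, ∑ l ∈ Finset.range n, P j l = W n P j := fun j => by
      rw [W, Finset.sum_range_succ, h.vanish' j n le_rfl, add_zero]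
    have z' : ∀ j, ∑ l ∈ Finset.range (n+1), P j l = W n P j := fun j => rfl
    rw [z, z, z', z'] at this
    have := h.W_mono i
    have := h.W_mono (i+1)
    have e : W n P (i+2) = W n P (i+1+1) := rfl
    unfold wt
    omega
  · rw [h.wt_zero (i+1) hi]
    have := hlam i
    omega

lemma sh_n (h0 : lam n = 0) (h : IsGT n mu P) : sh n lam P n = 0 := by
  simp [sh, h0, h.wt_zero n le_rfl]

open Classical in
theorem S_mul_S (hlam : ∀ i, lam (i+1) ≤ lam i) (h0 : lam n = 0) :
    S n lam * S n mu = ∑ P ∈ (GT n mu).filter (Good n lam), S n (sh n lam P) := by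
  apply mul_left_cancel₀ (alt_rho_ne (n := n))
  rw [← mul_assoc, alt_rho_mul_S hlam h0, alt_mul_good hlam, Finset.mul_sum]
  apply Finset.sum_congr rfl
  intro P hP
  rw [Finset.mem_filter, mem_GT] at hP
  rw [alt_rho_mul_S (sh_anti hlam hP.1 hP.2) (sh_n h0 hP.1)]
  apply alt_congr
  intro i _
  unfold sh
  ring

/-- Chains of shapes describing skew tableaux. -/
structure Chain (lam nu : ℕ → ℕ) (Q : ℕ → ℕ → ℕ) : Prop where
  zero : Q 0 = lam
  mono : ∀ k i, Q k i ≤ Q (k+1) i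
  inter : ∀ k i, Q (k+1) (i+1) ≤ Q k i
  ev : ∀ i, ∃ K, ∀ k, K ≤ k → Q k i = nu i

variable {nu : ℕ → ℕ} {Q : ℕ → ℕ → ℕ}

lemma Chain.mono' (h : Chain lam nu Q) {k k' : ℕ} (hk : k ≤ k') (i : ℕ) : Q k i ≤ Q k' i :=
  monotone_nat_of_le_succ (f := fun k => Q k i) (fun k => h.mono k i) hk

lemma Chain.ge (h : Chain lam nu Q) (k i : ℕ) : lam i ≤ Q k i := by
  have := h.mono' (Nat.zero_le k) i
  rwa [h.zero] at this

lemma Chain.le (h : Chain lam nu Q) (k i : ℕ) : Q k i ≤ nu i := by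
  obtain ⟨K, hK⟩ := h.ev i
  rw [← hK (max k K) (le_max_right _ _)]
  exact h.mono' (le_max_left _ _) i

lemma Chain.anti (h : Chain lam nu Q) (k : ℕ) : Antitone (Q k) :=
  antitone_nat_of_succ_le fun i => (h.mono k (i+1)).trans (h.inter k i)

lemma skew_ext {S T : SkewSSYT lam nu} (h : S.entry = T.entry) : S = T := by
  cases S; cases T; congr

lemma ssyt_ext {S T : SSYT lam n} (h : S.entry = T.entry) : S = T := by
  cases S; cases T; congr

/-- The chain of a skew tableau. -/
def chainOf (T : SkewSSYT lam nu) (k i : ℕ) : ℕ :=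
  lam i + ((Finset.Ico (lam i) (nu i)).filter fun j => T.entry i j ≤ k).card

lemma chainOf_spec (T : SkewSSYT lam nu) {i j : ℕ} (k : ℕ) (h1 : lam i ≤ j) (h2 : j < nu i) :
    T.entry i j ≤ k ↔ j < chainOf T k i := by
  unfold chainOf
  constructor
  · intro h
    have : Finset.Ico (lam i) (j+1) ⊆
        (Finset.Ico (lam i) (nu i)).filter fun j => T.entry i j ≤ k := by
      intro x hx
      rw [Finset.mem_Ico] at hx
      rw [Finset.mem_filter, Finset.mem_Ico]
      exact ⟨⟨hx.1, by omega⟩, (T.rowWeak i x j hx.1 (by omega) h2).trans h⟩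
    have := Finset.card_le_card this
    rw [Nat.card_Ico] at this
    omega
  · intro h
    by_contra hc
    have : ((Finset.Ico (lam i) (nu i)).filter fun j => T.entry i j ≤ k) ⊆
        Finset.Ico (lam i) j := by
      intro x hx
      rw [Finset.mem_filter, Finset.mem_Ico] at hx
      rw [Finset.mem_Ico]
      refine ⟨hx.1.1, ?_⟩
      by_contra hxj
      exact hc ((T.rowWeak i j x h1 (by omega) hx.1.2).trans hx.2)
    have := Finset.card_le_card this
    rw [Nat.card_Ico] at this
    omega

lemma chainOf_ge (T : SkewSSYT lam nu) (k i : ℕ) : lam i ≤ chainOf T k i := Nat.le_add_right _ _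

lemma chainOf_le (T : SkewSSYT lam nu) (hle : ∀ i, lam i ≤ nu i) (k i : ℕ) :
    chainOf T k i ≤ nu i := by
  unfold chainOf
  have := Finset.card_filter_le (Finset.Ico (lam i) (nu i)) fun j => T.entry i j ≤ k
  rw [Nat.card_Ico] at this
  have := hle i
  omega

lemma chainOf_chain (T : SkewSSYT lam nu) (hlam : ∀ i, lam (i+1) ≤ lam i)
    (hnu : ∀ i, nu (i+1) ≤ nu i) (hle : ∀ i, lam i ≤ nu i) : Chain lam nu (chainOf T) := by
  constructor
  · funext i
    apply le_antisymm _ (chainOf_ge T 0 i)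
    by_contra hc
    push Not at hc
    have h1 := chainOf_le T hle 0 i
    have := (chainOf_spec T 0 le_rfl (by omega)).mpr hc
    have := T.pos i (lam i) le_rfl (by omega)
    omega
  · intro k i
    unfold chainOf
    gcongr
    omega
  · intro k i
    by_contra hc
    push Not at hc
    have h1 := chainOf_ge T k i
    have h2 := chainOf_le T hle (k+1) (i+1)
    have h3 := hlam i
    have h4 := hnu i
    have a := (chainOf_spec T (i := i+1) (j := chainOf T k i) (k+1) (by omega) (by omega)).mpr hc
    have b := (chainOf_spec T (i := i) (j := chainOf T k i) k (by omega) (by omega)).not.mpr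
      (lt_irrefl _)
    have := T.colStrict i (i+1) (chainOf T k i) (by omega) (by omega) (by omega) (by omega)
      (by omega)
    omega
  · intro i
    refine ⟨T.entry i (nu i - 1), fun k hk => ?_⟩
    apply le_antisymm (chainOf_le T hle k i)
    by_contra hc
    have h1 := chainOf_ge T k i
    have := (chainOf_spec T (i := i) (j := nu i - 1) k (by omega) (by omega)).mp hk
    omega

open Classical in
/-- Entry of the tableau of a chain. -/
noncomputable def entryOf (lam nu : ℕ → ℕ) (Q : ℕ → ℕ → ℕ) (i j : ℕ) : ℕ :=
  if lam i ≤ j ∧ j < nu i then sInf {k | j < Q k i} else 0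

lemma entryOf_spec (h : Chain lam nu Q) {i j : ℕ} (k : ℕ) (h1 : lam i ≤ j) (h2 : j < nu i) :
    entryOf lam nu Q i j ≤ k ↔ j < Q k i := by
  rw [entryOf, if_pos ⟨h1, h2⟩]
  constructor
  · intro hk
    obtain ⟨K, hK⟩ := h.ev i
    have hne : {k | j < Q k i}.Nonempty := ⟨K, by simp [hK K le_rfl, h2]⟩
    have := Nat.sInf_mem hne
    exact lt_of_lt_of_le this (h.mono' hk i)
  · intro hk; exact Nat.sInf_le hk

lemma entryOf_pos (h : Chain lam nu Q) {i j : ℕ} (h1 : lam i ≤ j) (h2 : j < nu i) :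
    1 ≤ entryOf lam nu Q i j := by
  by_contra hc
  have := (entryOf_spec h 0 h1 h2).mp (by omega)
  rw [h.zero] at this
  omega

/-- The tableau of a chain. -/
noncomputable def tabOf (h : Chain lam nu Q) : SkewSSYT lam nu where
  entry := entryOf lam nu Q
  pos := fun i j h1 h2 => entryOf_pos h h1 h2
  zero := fun i j hc => by rw [entryOf, if_neg hc]
  rowWeak := fun i j j' h1 h2 h3 => by
    rw [entryOf_spec h _ h1 (by omega)]
    have := (entryOf_spec h (i := i) (j := j') _ (by omega) h3).mp le_rfl
    omega
  colStrict := fun i i' j hi h1 h2 h3 h4 => by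
    have hp := entryOf_pos h h3 h4
    have a := (entryOf_spec h _ h3 h4).mp le_rfl
    obtain ⟨e, he⟩ : ∃ e, entryOf lam nu Q i' j = e + 1 := ⟨_, (Nat.sub_add_cancel hp).symm⟩
    obtain ⟨m, rfl⟩ : ∃ m, i' = m + 1 := ⟨i' - 1, by omega⟩
    rw [he] at a ⊢
    rw [Nat.lt_succ_iff, entryOf_spec h _ h1 h2]
    have b := h.inter e m
    have c := h.anti e (by omega : i ≤ m)
    omega

lemma eq_of_le_iff {a b : ℕ} (h : ∀ k, a ≤ k ↔ b ≤ k) : a = b :=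
  le_antisymm ((h b).mpr le_rfl) ((h a).mp le_rfl)

lemma tabOf_chainOf (T : SkewSSYT lam nu) (h : Chain lam nu (chainOf T)) : tabOf h = T := by
  apply skew_ext
  funext i j
  by_cases hb : lam i ≤ j ∧ j < nu i
  · apply eq_of_le_iff
    intro k
    rw [chainOf_spec T k hb.1 hb.2]
    exact entryOf_spec h k hb.1 hb.2
  · rw [T.zero i j hb, (tabOf h).zero i j hb]

lemma chainOf_tabOf (h : Chain lam nu Q) : chainOf (tabOf h) = Q := by
  have hle : ∀ i, lam i ≤ nu i := fun i => (h.ge 0 i).trans (h.le 0 i)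
  funext k i
  have a1 := chainOf_ge (tabOf h) k i
  have a2 := chainOf_le (tabOf h) hle k i
  have b1 := h.ge k i
  have b2 := h.le k i
  have key : ∀ j, lam i ≤ j → j < nu i → (j < chainOf (tabOf h) k i ↔ j < Q k i) := by
    intro j h1 h2
    rw [← chainOf_spec _ k h1 h2]
    exact entryOf_spec h k h1 h2
  rcases lt_trichotomy (chainOf (tabOf h) k i) (Q k i) with e | e | e
  · have := key (chainOf (tabOf h) k i) a1 (by omega); omega
  · exact e
  · have := key (Q k i) b1 (by omega); omega

lemma entry_iff (T : SkewSSYT lam nu) (hle : ∀ i, lam i ≤ nu i) (i j k : ℕ) :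
    (lam i ≤ j ∧ j < nu i ∧ T.entry i j = k + 1) ↔
      chainOf T k i ≤ j ∧ j < chainOf T (k+1) i := by
  have a1 := chainOf_ge T k i
  have a2 := chainOf_le T hle (k+1) i
  constructor
  · rintro ⟨h1, h2, h3⟩
    have b := chainOf_spec T k h1 h2
    have c := chainOf_spec T (k+1) h1 h2
    omega
  · rintro ⟨h1, h2⟩
    have b := chainOf_spec T (i := i) (j := j) k (by omega) (by omega)
    have c := chainOf_spec T (i := i) (j := j) (k+1) (by omega) (by omega)
    omega

lemma box_card (N : ℕ) (a b : ℕ → ℕ) :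
    {p : ℕ × ℕ | p.1 < N ∧ a p.1 ≤ p.2 ∧ p.2 < b p.1}.ncard =
      ∑ i ∈ Finset.range N, (b i - a i) := by
  have : {p : ℕ × ℕ | p.1 < N ∧ a p.1 ≤ p.2 ∧ p.2 < b p.1} =
      ((Finset.range N).biUnion fun i => (Finset.Ico (a i) (b i)).image (Prod.mk i) :
        Finset (ℕ × ℕ)) := by
    ext ⟨x, y⟩
    simp
    tauto
  rw [this, Set.ncard_coe_finset, Finset.card_biUnion]
  · apply Finset.sum_congr rfl
    intro i _
    rw [Finset.card_image_of_injective _ (Prod.mk_right_injective i), Nat.card_Ico]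
  · intro i _ j _ hij
    rw [Function.onFun, Finset.disjoint_left]
    rintro ⟨x, y⟩ h1 h2
    simp at h1 h2
    omega

/-! Ordinary tableaux. -/

/-- An ordinary tableau as a skew tableau. -/
def toSkew (T : SSYT mu n) : SkewSSYT (fun _ => 0) mu where
  entry := T.entry
  pos := fun i j _ h => (T.pos i j h).1
  zero := fun i j h => T.zero i j (by simpa using h)
  rowWeak := fun i j j' _ h1 h2 => T.rowWeak i j j' h1 h2
  colStrict := fun i i' j h _ h1 _ h2 => T.colStrict i i' j h h1 h2

lemma chain_of_GT (h : IsGT n mu P) : Chain (fun _ => 0) mu P where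
  zero := funext h.zero
  mono := h.mono
  inter := h.inter
  ev := fun i => ⟨n, fun k hk => by rw [h.top k hk]⟩

lemma GT_of_ssyt (hmu : ∀ i, mu (i+1) ≤ mu i) (T : SSYT mu n) :
    IsGT n mu (chainOf (toSkew T)) := by
  have h := chainOf_chain (toSkew T) (fun _ => le_rfl) hmu (fun _ => Nat.zero_le _)
  refine ⟨fun k => by rw [h.zero], h.mono, h.inter, fun k hk => ?_⟩
  funext i
  apply le_antisymm (h.le k i)
  by_contra hc
  push Not at hc
  have a := (chainOf_spec (toSkew T) (i := i) (j := mu i - 1) k (Nat.zero_le _) (by omega)).mp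
    ((T.pos i (mu i - 1) (by omega)).2.trans hk)
  omega

/-- The ordinary tableau of a pattern. -/
noncomputable def ssytOf (h : IsGT n mu P) : SSYT mu n where
  entry := (tabOf (chain_of_GT h)).entry
  pos := fun i j hj => ⟨(tabOf (chain_of_GT h)).pos i j (Nat.zero_le _) hj,
    (entryOf_spec (chain_of_GT h) n (Nat.zero_le _) hj).mpr (by rw [h.top n le_rfl]; exact hj)⟩
  zero := fun i j hj => (tabOf (chain_of_GT h)).zero i j (by simpa using hj)
  rowWeak := fun i j j' h1 h2 => (tabOf (chain_of_GT h)).rowWeak i j j' (Nat.zero_le _) h1 h2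
  colStrict := fun i i' j h0 h1 h2 => (tabOf (chain_of_GT h)).colStrict i i' j h0
    (Nat.zero_le _) h1 (Nat.zero_le _) h2

/-- Tableaux correspond to patterns. -/
noncomputable def ssytEquiv (hmu : ∀ i, mu (i+1) ≤ mu i) : SSYT mu n ≃ {P | IsGT n mu P} where
  toFun T := ⟨chainOf (toSkew T), GT_of_ssyt hmu T⟩
  invFun P := ssytOf P.2
  left_inv T := by
    apply ssyt_ext
    exact congrArg SkewSSYT.entry (tabOf_chainOf (toSkew T) (chain_of_GT (GT_of_ssyt hmu T)))
  right_inv P := by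
    apply Subtype.ext
    exact chainOf_tabOf (chain_of_GT P.2)

lemma ssyt_wt (hmu : ∀ i, mu (i+1) ≤ mu i) (T : SSYT mu n) (i : ℕ) :
    T.wt (i+1) = wt n (chainOf (toSkew T)) i := by
  have h := GT_of_ssyt hmu T
  have e : {p : ℕ × ℕ | p.2 < mu p.1 ∧ T.entry p.1 p.2 = i + 1} =
      {p : ℕ × ℕ | p.1 < n + 1 ∧ chainOf (toSkew T) i p.1 ≤ p.2 ∧
        p.2 < chainOf (toSkew T) (i+1) p.1} := by
    ext ⟨x, y⟩
    have := entry_iff (toSkew T) (fun _ => Nat.zero_le _) x y i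
    simp only [Set.mem_ofPred_eq]
    rw [← this]
    constructor
    · rintro ⟨h1, h2⟩
      refine ⟨?_, Nat.zero_le _, h1, h2⟩
      by_contra hc
      have := h.vanish' n x (by omega)
      rw [h.top n le_rfl] at this
      omega
    · rintro ⟨_, _, h1, h2⟩
      exact ⟨h1, h2⟩
  rw [SSYT.wt, e, box_card, wt, W, W, ← Finset.sum_tsub_distrib]
  intro k _
  exact h.mono i k

lemma schurPoly_eq (hmu : ∀ i, mu (i+1) ≤ mu i) : schurPoly n mu = S n mu := by
  rw [schurPoly, S, GT, ← finsum_mem_eq_finite_toFinset_sum, ← finsum_set_coe_eq_finsum_mem]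
  apply finsum_eq_of_bijective (ssytEquiv hmu) (ssytEquiv hmu).bijective
  intro T
  unfold ssytMonomial
  apply Finset.prod_congr rfl
  intro i _
  rw [ssyt_wt hmu T i]
  rfl

/-! Littlewood-Richardson tableaux. -/

/-- Companion pattern of a chain. -/
def PofQ (Q : ℕ → ℕ → ℕ) (i k : ℕ) : ℕ := ∑ i' ∈ Finset.range i, (Q (k+1) i' - Q k i')

/-- Companion chain of a pattern. -/
def QofP (lam : ℕ → ℕ) (P : ℕ → ℕ → ℕ) (k i : ℕ) : ℕ :=
  lam i + ∑ l ∈ Finset.range k, (P (i+1) l - P i l)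

lemma QofP_PofQ (h : Chain lam nu Q) : QofP lam (PofQ Q) = Q := by
  funext k i
  have e : ∀ l, PofQ Q (i+1) l - PofQ Q i l = Q (l+1) i - Q l i := by
    intro l
    simp only [PofQ, Finset.sum_range_succ]
    omega
  simp only [QofP, e]
  induction k with
  | zero => simp [h.zero]
  | succ k ih =>
    rw [Finset.sum_range_succ]
    have := h.mono k i
    omega

lemma PofQ_QofP (h : IsGT n mu P) : PofQ (QofP lam P) = P := by
  funext i k
  have e : ∀ l, QofP lam P (k+1) l - QofP lam P k l = P (l+1) k - P l k := by
    intro l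
    simp only [QofP, Finset.sum_range_succ]
    omega
  simp only [PofQ, e]
  induction i with
  | zero => simp [h.zero]
  | succ i ih =>
    rw [Finset.sum_range_succ, ih]
    have := h.mono i k
    omega

lemma G_iff (h : IsGT n mu P) (i k : ℕ) :
    G lam P i k ↔ QofP lam P (k+1) (i+1) ≤ QofP lam P k i := by
  unfold G QofP
  rw [Finset.sum_tsub_distrib _ (fun l _ => h.mono (i+1) l),
    Finset.sum_tsub_distrib _ (fun l _ => h.mono i l)]
  have a : ∑ l ∈ Finset.range (k+1), P (i+1) l ≤ ∑ l ∈ Finset.range (k+1), P (i+1+1) l :=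
    Finset.sum_le_sum fun l _ => h.mono (i+1) l
  have b : ∑ l ∈ Finset.range k, P i l ≤ ∑ l ∈ Finset.range k, P (i+1) l :=
    Finset.sum_le_sum fun l _ => h.mono i l
  change lam (i+1) + ∑ l ∈ Finset.range (k+1), P (i+1+1) l + _ ≤ _ ↔ _
  omega

lemma QofP_ev (h : IsGT n mu P) (i k : ℕ) (hk : n + 1 ≤ k) : QofP lam P k i = sh n lam P i := by
  unfold QofP sh wt W
  rw [← Finset.sum_tsub_distrib _ (fun l _ => h.mono i l)]
  congr 1
  symm
  apply Finset.sum_subset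
  · intro x hx; simp at *; omega
  · intro x _ hx
    simp at hx
    rw [h.vanish' (i+1) x (by omega), Nat.zero_sub]

lemma QofP_chain (hlam : ∀ i, lam (i+1) ≤ lam i) (h : IsGT n mu P) (hg : Good n lam P) :
    Chain lam (sh n lam P) (QofP lam P) where
  zero := by funext i; simp [QofP]
  mono := fun k i => by simp [QofP, Finset.sum_range_succ]
  inter := fun k i => by
    rcases lt_or_ge (i+1) n with hi | hi
    · exact (G_iff h i k).mp (hg i k hi)
    · have := hlam i
      simp only [QofP, h.top (i+1) hi, h.top (i+1+1) (by omega)]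
      simp
      omega
  ev := fun i => ⟨n+1, fun k hk => QofP_ev h i k hk⟩

lemma QofP_chain' (hlam : ∀ i, lam (i+1) ≤ lam i) (h : IsGT n mu P) (hg : Good n lam P)
    (he : sh n lam P = nu) : Chain lam nu (QofP lam P) := he ▸ QofP_chain hlam h hg

lemma content_iff (T : SkewSSYT lam nu) (hle : ∀ i, lam i ≤ nu i) (hz : ∀ i, n ≤ i → nu i = 0) :
    T.HasContent mu ↔ ∀ k, PofQ (chainOf T) n k = mu k := by
  unfold SkewSSYT.HasContent
  apply forall_congr'
  intro k
  have : {p : ℕ × ℕ | lam p.1 ≤ p.2 ∧ p.2 < nu p.1 ∧ T.entry p.1 p.2 = k + 1} =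
      {p : ℕ × ℕ | p.1 < n ∧ chainOf T k p.1 ≤ p.2 ∧ p.2 < chainOf T (k+1) p.1} := by
    ext ⟨x, y⟩
    simp only [Set.mem_ofPred_eq]
    rw [entry_iff T hle]
    constructor
    · intro h
      refine ⟨?_, h⟩
      by_contra hc
      have := hz x (by omega)
      have := chainOf_le T hle (k+1) x
      omega
    · exact fun h => h.2
  rw [this, box_card]
  rfl

lemma read_card (T : SkewSSYT lam nu) (hle : ∀ i, lam i ≤ nu i) (i j k : ℕ) :
    {q : ℕ × ℕ | lam q.1 ≤ q.2 ∧ q.2 < nu q.1 ∧ readBefore (i, j) q ∧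
        T.entry q.1 q.2 = k + 1}.ncard =
    PofQ (chainOf T) i k + (chainOf T (k+1) i - max (chainOf T k i) j) := by
  have : {q : ℕ × ℕ | lam q.1 ≤ q.2 ∧ q.2 < nu q.1 ∧ readBefore (i, j) q ∧
        T.entry q.1 q.2 = k + 1} =
      {p : ℕ × ℕ | p.1 < i + 1 ∧
        (fun x => if x < i then chainOf T k x else max (chainOf T k i) j) p.1 ≤ p.2 ∧
        p.2 < chainOf T (k+1) p.1} := by
    ext ⟨x, y⟩
    have := entry_iff T hle x y k
    simp only [Set.mem_ofPred_eq, readBefore]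
    rcases lt_trichotomy x i with e | e | e
    · simp only [e, if_true, true_or, true_and, Nat.lt_succ_of_lt e]
      omega
    · subst e
      simp only [lt_irrefl, if_false, max_le_iff, false_or, true_and, Nat.lt_succ_self]
      omega
    · omega
  rw [this]
  refine (box_card (i+1) (fun x => if x < i then chainOf T k x else max (chainOf T k i) j)
    (chainOf T (k+1))).trans ?_
  rw [Finset.sum_range_succ, PofQ]
  simp only [lt_irrefl, if_false]
  congr 1
  apply Finset.sum_congr rfl
  intro x hx
  rw [if_pos (Finset.mem_range.mp hx)]

lemma PofQ_mono (Q : ℕ → ℕ → ℕ) (i k : ℕ) : PofQ Q i k ≤ PofQ Q (i+1) k := by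
  simp [PofQ, Finset.sum_range_succ]

lemma yam_iff (T : SkewSSYT lam nu) (h : Chain lam nu (chainOf T)) (hle : ∀ i, lam i ≤ nu i) :
    T.IsYamanouchi ↔
      ∀ i k, PofQ (chainOf T) (i+1) (k+1) ≤ PofQ (chainOf T) i k := by
  constructor
  · intro hy i k
    induction i with
    | zero =>
      by_contra hc
      simp only [PofQ, Finset.sum_range_succ, Finset.sum_range_zero] at hc
      have a := h.ge (k+1) 0
      have b := h.le (k+1+1) 0
      have := hy (0, chainOf T (k+1) 0) a (by change _ < nu 0; omega) k
      rw [read_card T hle 0 _ (k+1), read_card T hle 0 _ k] at this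
      simp only [PofQ, Finset.sum_range_zero] at this
      omega
    | succ i ih =>
      by_cases he : chainOf T (k+1) (i+1) < chainOf T (k+1+1) (i+1)
      · have a := h.ge (k+1) (i+1)
        have b := h.le (k+1+1) (i+1)
        have := hy (i+1, chainOf T (k+1) (i+1)) a (by change _ < nu (i+1); omega) k
        rw [read_card T hle (i+1) _ (k+1), read_card T hle (i+1) _ k] at this
        have e : PofQ (chainOf T) (i+1+1) (k+1) = PofQ (chainOf T) (i+1) (k+1) +
          (chainOf T (k+1+1) (i+1) - chainOf T (k+1) (i+1)) := Finset.sum_range_succ _ _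
        omega
      · have e : PofQ (chainOf T) (i+1+1) (k+1) = PofQ (chainOf T) (i+1) (k+1) +
          (chainOf T (k+1+1) (i+1) - chainOf T (k+1) (i+1)) := Finset.sum_range_succ _ _
        have := PofQ_mono (chainOf T) i k
        omega
  · rintro hP ⟨i, j⟩ h1 h2 k
    rw [read_card T hle i j (k+1), read_card T hle i j k]
    have := hP i k
    have e : PofQ (chainOf T) (i+1) (k+1) = PofQ (chainOf T) i (k+1) +
          (chainOf T (k+1+1) i - chainOf T (k+1) i) := Finset.sum_range_succ _ _
    omega

lemma GT_of_LR (T : SkewSSYT lam nu) (h : Chain lam nu (chainOf T)) (hle : ∀ i, lam i ≤ nu i)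
    (hz : ∀ i, n ≤ i → nu i = 0) (hc : T.HasContent mu) (hy : T.IsYamanouchi) :
    IsGT n mu (PofQ (chainOf T)) := by
  rw [content_iff T hle hz] at hc
  rw [yam_iff T h hle] at hy
  refine ⟨fun k => by simp [PofQ], PofQ_mono _, hy, ?_⟩
  intro i hi
  funext k
  rw [← hc k]
  symm
  apply Finset.sum_subset
  · intro x hx; simp at *; omega
  · intro x _ hx
    simp at hx
    have := hz x hx
    have := h.le (k+1) x
    omega

open Classical in
/-- Littlewood-Richardson tableaux correspond to good patterns. -/
noncomputable def lrEquiv (hlam : ∀ i, lam (i+1) ≤ lam i)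
    (hnu : ∀ i, nu (i+1) ≤ nu i) (hle : ∀ i, lam i ≤ nu i) (hz : ∀ i, n ≤ i → nu i = 0) :
    {T : SkewSSYT lam nu // T.HasContent mu ∧ T.IsYamanouchi} ≃
      {P // P ∈ ((GT n mu).filter (Good n lam)).filter fun P => sh n lam P = nu} where
  toFun T := ⟨PofQ (chainOf T.1), by
    have h := chainOf_chain T.1 hlam hnu hle
    have hG := GT_of_LR T.1 h hle hz T.2.1 T.2.2
    rw [Finset.mem_filter, Finset.mem_filter, mem_GT]
    refine ⟨⟨hG, ?_⟩, ?_⟩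
    · intro i k _
      rw [G_iff hG, QofP_PofQ h]
      exact h.inter k i
    · funext i
      obtain ⟨K, hK⟩ := h.ev i
      rw [← QofP_ev hG i (max K (n+1)) (le_max_right _ _), QofP_PofQ h]
      exact hK _ (le_max_left _ _)⟩
  invFun P := by
    have hP := P.2
    rw [Finset.mem_filter, Finset.mem_filter, mem_GT] at hP
    have h : Chain lam nu (QofP lam P.1) := QofP_chain' hlam hP.1.1 hP.1.2 hP.2
    refine ⟨tabOf h, ?_, ?_⟩
    · rw [content_iff _ hle hz, chainOf_tabOf, PofQ_QofP hP.1.1, hP.1.1.top n le_rfl]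
      exact fun _ => rfl
    · rw [yam_iff _ (by rw [chainOf_tabOf]; exact h) hle, chainOf_tabOf, PofQ_QofP hP.1.1]
      exact hP.1.1.inter
  left_inv T := by
    have h := chainOf_chain T.1 hlam hnu hle
    apply Subtype.ext
    apply skew_ext
    have e := congrArg SkewSSYT.entry (tabOf_chainOf T.1 h)
    rw [← e]
    change entryOf lam nu (QofP lam (PofQ (chainOf T.1))) = entryOf lam nu (chainOf T.1)
    rw [QofP_PofQ h]
  right_inv P := by
    have hP := P.2
    rw [Finset.mem_filter, Finset.mem_filter, mem_GT] at hP
    apply Subtype.ext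
    change PofQ (chainOf (tabOf (QofP_chain' hlam hP.1.1 hP.1.2 hP.2))) = P.1
    rw [chainOf_tabOf, PofQ_QofP hP.1.1]

open Classical in
lemma lrCoeff_eq (hlam : ∀ i, lam (i+1) ≤ lam i)
    (hnu : ∀ i, nu (i+1) ≤ nu i) (hle : ∀ i, lam i ≤ nu i) (hz : ∀ i, n ≤ i → nu i = 0) :
    lrCoeff lam mu nu =
      (((GT n mu).filter (Good n lam)).filter fun P => sh n lam P = nu).card := by
  rw [lrCoeff, Nat.card_congr (lrEquiv (n := n) hlam hnu hle hz), Nat.card_eq_fintype_card,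
    Fintype.card_coe]

open Classical in
theorem main (n : ℕ) (lam mu : ℕ → ℕ) (hlam : IsPartition lam) (hmu : IsPartition mu) :
    schurPoly n lam * schurPoly n mu =
      ∑ᶠ (nu : ℕ → ℕ) (_ : IsPartition nu ∧ ∀ i, lam i ≤ nu i),
        (lrCoeff lam mu nu : ℤ) • schurPoly n nu := by
  have hl : ∀ i, lam (i+1) ≤ lam i := fun i => hlam.1 _ _ (by omega)
  have hm : ∀ i, mu (i+1) ≤ mu i := fun i => hmu.1 _ _ (by omega)
  have hS : ∀ nu, IsPartition nu → schurPoly n nu = S n nu := fun nu h =>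
    schurPoly_eq fun i => h.1 _ _ (by omega)
  rw [hS lam hlam, hS mu hmu]
  by_cases h0 : lam n = 0
  swap
  · rw [S_eq_zero h0, zero_mul]
    symm
    apply finsum_eq_zero_of_forall_eq_zero
    intro nu
    rw [finsum_eq_if]
    split_ifs with h
    · rw [hS nu h.1, S_eq_zero (by have := h.2 n; omega), smul_zero]
    · rfl
  have hlz : ∀ i, n ≤ i → lam i = 0 := fun i hi => by have := hlam.1 _ _ hi; omega
  rw [S_mul_S hl h0]
  set F := (GT n mu).filter (Good n lam) with hF
  have hsh : ∀ P ∈ F, IsPartition (sh n lam P) ∧ ∀ i, lam i ≤ sh n lam P i := by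
    intro P hP
    rw [hF, Finset.mem_filter, mem_GT] at hP
    refine ⟨⟨antitone_nat_of_succ_le (sh_anti hl hP.1 hP.2), n, fun i hi => ?_⟩,
      fun i => Nat.le_add_right _ _⟩
    rw [sh, hlz i hi, hP.1.wt_zero i hi]
  have hterm : ∀ nu : ℕ → ℕ, (∑ᶠ (_ : IsPartition nu ∧ ∀ i, lam i ≤ nu i),
        (lrCoeff lam mu nu : ℤ) • schurPoly n nu) =
        ∑ P ∈ F.filter (fun P => sh n lam P = nu), S n nu := by
    intro nu
    rw [finsum_eq_if]
    split_ifs with h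
    · rw [hS nu h.1, Finset.sum_const]
      by_cases hn : nu n = 0
      · rw [lrCoeff_eq (n := n) hl (fun i => h.1.1 _ _ (by omega)) h.2
          (fun i hi => by have := h.1.1 _ _ hi; omega), ← hF]
        exact natCast_zsmul _ _
      · rw [S_eq_zero hn, smul_zero, smul_zero]
    · symm
      apply Finset.sum_eq_zero
      intro P hP
      rw [Finset.mem_filter] at hP
      exact absurd (hP.2 ▸ hsh P hP.1) h
  simp only [hterm]
  rw [finsum_eq_sum_of_support_subset (s := F.image (sh n lam))]
  · rw [← Finset.sum_fiberwise_of_maps_to (g := sh n lam) (t := F.image (sh n lam))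
      (fun P hP => Finset.mem_image_of_mem _ hP)]
    apply Finset.sum_congr rfl
    intro nu _
    apply Finset.sum_congr rfl
    intro P hP
    rw [Finset.mem_filter] at hP
    rw [hP.2]
  · intro nu hnu
    rw [Function.mem_support] at hnu
    by_contra hc
    apply hnu
    apply Finset.sum_eq_zero
    intro P hP
    rw [Finset.mem_filter] at hP
    exact absurd (Finset.mem_coe.mpr (Finset.mem_image.mpr ⟨P, hP.1, hP.2⟩)) hc

end LR

/-- **The Littlewood–Richardson rule**: `s_λ · s_μ = ∑_ν c_{λ,μ}^ν s_ν`, where `c_{λ,μ}^ν`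
counts Yamanouchi semistandard skew tableaux of shape `ν/λ` and content `μ`.  In particular
all structure coefficients of the Schur basis are nonnegative integers. -/
theorem littlewood_richardson (n : ℕ) (lam mu : ℕ → ℕ)
    (hlam : IsPartition lam) (hmu : IsPartition mu) :
    schurPoly n lam * schurPoly n mu =
      ∑ᶠ (nu : ℕ → ℕ) (_ : IsPartition nu ∧ ∀ i, lam i ≤ nu i),
        (lrCoeff lam mu nu : ℤ) • schurPoly n nu := by
  exact LR.main n lam mu hlam hmu
end

section
/- For every strong composition α, the quasiSchur polynomial expands positively in fundamental quasisymmetric polynomials: S_α(x_1,…,x_n) = ∑_T F_{wt(T)}(x_1,…,x_n), where the sum is over all initial quasiYamanouchi semistandard composition tableaux T ∈ ASSF(a) for weak compositions a of length n with a^+ = α. -/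
open MvPolynomial

/-- The monomial `x^b` in `n` variables. -/
noncomputable def xpow (n : ℕ) (b : Fin n → ℕ) : MvPolynomial (Fin n) ℤ :=
  ∏ i, X i ^ b i

/-- The positive part of a weak composition: delete all zero entries. -/
def posPart {n : ℕ} (b : Fin n → ℕ) : List ℕ :=
  (List.ofFn b).filter (fun x => x ≠ 0)

/-- `β` refines `α`: `α` is obtained by summing consecutive (nonempty) blocks of `β`. -/
def Refines (β α : List ℕ) : Prop :=
  ∃ L : List (List ℕ), L.flatten = β ∧ L.map List.sum = α ∧ ∀ l ∈ L, l ≠ []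

/-- The fundamental quasisymmetric polynomial `F_α(x_1, …, x_n)`. -/
noncomputable def Fq (n : ℕ) (α : List ℕ) : MvPolynomial (Fin n) ℤ :=
  ∑ᶠ (b : Fin n → ℕ) (_ : Refines (posPart b) α), xpow n b

/-- Semistandard composition tableaux of shape a weak composition `a` of length `n`. -/
structure ASSF (n : ℕ) (a : Fin n → ℕ) where
  entry : Fin n → ℕ → ℕ
  pos : ∀ i j, j < a i → 1 ≤ entry i j
  zero : ∀ i j, ¬ j < a i → entry i j = 0
  colDistinct : ∀ i i' j, i ≠ i' → j < a i → j < a i' → entry i j ≠ entry i' j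
  rowWeak : ∀ i j j', j ≤ j' → j' < a i → entry i j' ≤ entry i j
  triple1 : ∀ (i i' : Fin n) (j : ℕ), i < i' → a i' ≤ a i → j + 1 < a i → j + 1 < a i' →
    ¬ (entry i (j + 1) ≤ entry i' (j + 1) ∧ entry i' (j + 1) ≤ entry i j)
  triple2 : ∀ (i i' : Fin n) (j : ℕ), i' < i → a i' < a i → j + 1 < a i → j + 1 < a i' →
    ¬ (entry i (j + 1) ≤ entry i' (j + 1) ∧ entry i' (j + 1) ≤ entry i j)
  firstCol : ∀ i, 0 < a i → entry i 0 = (i : ℕ) + 1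

/-- The weight of a composition tableau: `T.wt k` is the number of boxes labelled `k+1`. -/
noncomputable def ASSF.wt {n : ℕ} {a : Fin n → ℕ} (T : ASSF n a) (k : Fin n) : ℕ :=
  {p : Fin n × ℕ | p.2 < a p.1 ∧ T.entry p.1 p.2 = (k : ℕ) + 1}.ncard

/-- The quasiSchur polynomial `S_α(x_1, …, x_n)`. -/
noncomputable def quasiSchur (n : ℕ) (α : List ℕ) : MvPolynomial (Fin n) ℤ :=
  ∑ᶠ (a : Fin n → ℕ) (_ : posPart a = α), ∑ᶠ T : ASSF n a, xpow n T.wt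

/-- The label `m` appears in `T`. -/
def ASSF.Appears {n : ℕ} {a : Fin n → ℕ} (T : ASSF n a) (m : ℕ) : Prop :=
  ∃ (i : Fin n) (j : ℕ), j < a i ∧ T.entry i j = m

/-- `T` is quasiYamanouchi: for every integer `m` appearing in `T`, either an `m` appears
in the first column, or there is an `m+1` weakly right of an `m`. -/
def ASSF.QuasiYam {n : ℕ} {a : Fin n → ℕ} (T : ASSF n a) : Prop :=
  ∀ m : ℕ, T.Appears m →
    (∃ i : Fin n, 0 < a i ∧ T.entry i 0 = m) ∨
    (∃ (i i' : Fin n) (j j' : ℕ), j < a i ∧ j' < a i' ∧ j ≤ j' ∧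
      T.entry i j = m ∧ T.entry i' j' = m + 1)

/-- `T` is initial: the set of labels appearing in `T` is an initial segment of the
positive integers. -/
def ASSF.Initial {n : ℕ} {a : Fin n → ℕ} (T : ASSF n a) : Prop :=
  ∀ m : ℕ, 0 < m → T.Appears (m + 1) → T.Appears m

namespace QS

/-! ### Refinement through prefix sums -/

theorem refines_imp {β α : List ℕ} (h : Refines β α) :
    β.sum = α.sum ∧ ∀ p, p <+: α → ∃ q, q <+: β ∧ q.sum = p.sum := by
  obtain ⟨L, rfl, rfl, -⟩ := h
  refine ⟨List.sum_flatten, ?_⟩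
  intro p hp
  rw [List.prefix_iff_eq_take] at hp
  refine ⟨(L.take p.length).flatten, ?_, ?_⟩
  · conv_rhs => rw [← List.take_append_drop p.length L, List.flatten_append]
    exact List.prefix_append _ _
  · conv_rhs => rw [hp]
    rw [List.sum_flatten, List.map_take]

theorem refines_of {α : List ℕ} : ∀ {β : List ℕ}, (∀ x ∈ α, x ≠ 0) → (∀ x ∈ β, x ≠ 0) →
    β.sum = α.sum → (∀ p, p <+: α → ∃ q, q <+: β ∧ q.sum = p.sum) → Refines β α := by
  induction α with
  | nil =>
    intro β _ hβ hs _
    refine ⟨[], ?_, rfl, by simp⟩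
    cases β with
    | nil => rfl
    | cons y l =>
      exfalso
      have := hβ y (by simp)
      simp at hs
      omega
  | cons x α ih =>
    intro β hα hβ hs h
    obtain ⟨q, ⟨β', rfl⟩, hq⟩ := h [x] ⟨α, rfl⟩
    have hx := hα x (by simp)
    simp at hq hs
    obtain ⟨L, hL, hL2, hL3⟩ := @ih β' (fun y hy => hα y (by simp [hy]))
      (fun y hy => hβ y (by simp [hy])) (by omega) (by
        intro p' hp'
        obtain ⟨q', hq', hs'⟩ := h (x :: p') (by simpa using hp')
        simp at hs'
        rcases List.prefix_or_prefix_of_prefix hq' (List.prefix_append q β') with h1 | h1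
        · obtain ⟨t, rfl⟩ := h1
          simp at hq
          exact ⟨[], List.nil_prefix, by simp; omega⟩
        · obtain ⟨t, rfl⟩ := h1
          refine ⟨t, ?_, ?_⟩
          · simpa [List.prefix_append_right_inj] using hq'
          · simp at hs'; omega)
    refine ⟨q :: L, by simp [hL], by simp [hq, hL2], ?_⟩
    intro l hl
    rcases List.mem_cons.1 hl with rfl | hl
    · rintro rfl
      simp at hq; omega
    · exact hL3 l hl

/-- cumulative sums -/
def cum {n : ℕ} (b : Fin n → ℕ) (k : ℕ) : ℕ := ∑ i ∈ Finset.univ.filter (fun i : Fin n => (i : ℕ) < k), b i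

theorem sum_filter_ne (l : List ℕ) : (l.filter (fun x => x ≠ 0)).sum = l.sum := by
  induction l with
  | nil => rfl
  | cons x l ih =>
    by_cases hx : x = 0
    · subst hx; simpa using ih
    · rw [List.filter_cons_of_pos (by simpa using hx), List.sum_cons, List.sum_cons, ih]

theorem exists_of_filter_pre {l p : List ℕ} (h : p <+: l.filter (fun x => x ≠ 0)) :
    ∃ q, q <+: l ∧ p = q.filter (fun x => x ≠ 0) := by
  obtain ⟨t, ht⟩ := h
  obtain ⟨l1, l2, h1, h2, h3⟩ := List.filter_eq_append_iff.1 ht.symm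
  exact ⟨l1, ⟨l2, h1.symm⟩, h2.symm⟩

theorem posPart_initial_sums {n : ℕ} (b : Fin n → ℕ) (s : ℕ) :
    (∃ p, p <+: posPart b ∧ p.sum = s) ↔ ∃ k, cum b k = s := by
  constructor
  · rintro ⟨p, hp, rfl⟩
    obtain ⟨q, hq, rfl⟩ := exists_of_filter_pre hp
    refine ⟨q.length, ?_⟩
    rw [sum_filter_ne]
    rw [List.prefix_iff_eq_take] at hq
    conv_rhs => rw [hq]
    rw [List.sum_take_ofFn]
    rfl
  · rintro ⟨k, rfl⟩
    refine ⟨((List.ofFn b).take k).filter (fun x => x ≠ 0), ?_, ?_⟩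
    · exact (List.take_prefix _ _).filter _
    · rw [sum_filter_ne, List.sum_take_ofFn]; rfl

theorem posPart_sum {n : ℕ} (b : Fin n → ℕ) : (posPart b).sum = ∑ i, b i := by
  unfold _root_.posPart; rw [sum_filter_ne, List.sum_ofFn]

theorem posPart_ne {n : ℕ} (b : Fin n → ℕ) : ∀ x ∈ posPart b, x ≠ 0 := by
  intro x hx
  simpa using (List.mem_filter.1 hx).2

theorem refines_iff {n : ℕ} (b w : Fin n → ℕ) : Refines (posPart b) (posPart w) ↔
    ∑ i, b i = ∑ i, w i ∧ ∀ m, ∃ k, cum b k = cum w m := by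
  constructor
  · intro h
    obtain ⟨h1, h2⟩ := refines_imp h
    rw [posPart_sum, posPart_sum] at h1
    refine ⟨h1, fun m => ?_⟩
    obtain ⟨p, hp, hs⟩ := (posPart_initial_sums w (cum w m)).2 ⟨m, rfl⟩
    rw [← posPart_initial_sums, ← hs]
    exact h2 p hp
  · rintro ⟨h1, h2⟩
    apply refines_of (posPart_ne _) (posPart_ne _)
    · rwa [posPart_sum, posPart_sum]
    · intro p hp
      obtain ⟨m, hm⟩ := (posPart_initial_sums w p.sum).1 ⟨p, hp, rfl⟩
      rw [posPart_initial_sums, ← hm]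
      exact h2 m

/-! ### Core combinatorics -/

section core
variable {C : Type*} [Fintype C] (col : C → ℕ)

/-- two fillings have the same standardization -/
def Sim (E E' : C → ℕ) : Prop := ∀ c d, col c ≤ col d → (E d ≤ E c ↔ E' d ≤ E' c)

/-- column-injective -/
def CInj (E : C → ℕ) : Prop := ∀ c d, c ≠ d → col c = col d → E c ≠ E d

/-- initial and quasi-Yamanouchi -/
def IQ (E : C → ℕ) : Prop :=
  ∀ m, (∃ c, m < E c) → ∃ c d, E c = m ∧ E d = m + 1 ∧ col c ≤ col d

/-- standardization order -/
def slt (E : C → ℕ) (d c : C) : Prop := E d < E c ∨ (E d = E c ∧ col c < col d)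

variable {col}

theorem Sim.symm {E E' : C → ℕ} (h : Sim col E E') : Sim col E' E :=
  fun c d hc => (h c d hc).symm

theorem Sim.trans {E E' E'' : C → ℕ} (h : Sim col E E') (h' : Sim col E' E'') : Sim col E E'' :=
  fun c d hc => (h c d hc).trans (h' c d hc)

theorem card_pos_lt {pos : C → ℕ} (hi : Function.Injective pos) (hb : ∀ c, pos c < Fintype.card C)
    {B : ℕ} (hB : B ≤ Fintype.card C) : Fintype.card {c // pos c < B} = B := by
  classical
  have hbij : Function.Bijective (fun c => (⟨pos c, hb c⟩ : Fin (Fintype.card C))) := by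
    rw [Fintype.bijective_iff_injective_and_card]
    exact ⟨fun x y h => hi (by simpa using h), by simp⟩
  have : Function.Bijective (fun c : {c // pos c < B} => (⟨pos c.1, c.2⟩ : Fin B)) := by
    constructor
    · intro x y h
      exact Subtype.ext (hi (by simpa using h))
    · intro y
      obtain ⟨c, hc⟩ := hbij.2 ⟨y, lt_of_lt_of_le y.2 hB⟩
      have hc' : pos c = y := by simpa using hc
      exact ⟨⟨c, by omega⟩, Fin.ext hc'⟩
  simpa using Fintype.card_of_bijective this

theorem exists_pos {E : C → ℕ} (hE : CInj col E) : ∃ pos : C → ℕ, Function.Injective pos ∧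
    (∀ c, pos c < Fintype.card C) ∧ ∀ c d, pos d < pos c ↔ slt col E d c := by
  classical
  let pos : C → ℕ := fun c => (Finset.univ.filter (fun d => slt col E d c)).card
  have irr : ∀ c, ¬ slt col E c c := by intro c h; simp [slt] at h
  have tr : ∀ c d e, slt col E c d → slt col E d e → slt col E c e := by
    intro c d e h h'; unfold slt at *; omega
  have tot : ∀ c d, c ≠ d → slt col E c d ∨ slt col E d c := by
    intro c d h
    have := hE c d h
    unfold slt; omega
  have mono : ∀ c d, slt col E d c → pos d < pos c := by
    intro c d h
    apply Finset.card_lt_card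
    rw [Finset.ssubset_iff_of_subset]
    · exact ⟨d, by simpa using h, by simpa using irr d⟩
    · intro e he
      simp at he ⊢
      exact tr _ _ _ he h
  refine ⟨pos, ?_, ?_, ?_⟩
  · intro c d h
    by_contra hne
    rcases tot c d hne with h1 | h1
    · have := mono _ _ h1; omega
    · have := mono _ _ h1; omega
  · intro c
    apply Finset.card_lt_card
    rw [Finset.ssubset_iff_of_subset (Finset.subset_univ _)]
    exact ⟨c, by simp, by simpa using irr c⟩
  · intro c d
    refine ⟨fun h => ?_, mono c d⟩
    by_contra hn
    have hne : c ≠ d := by rintro rfl; omega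
    rcases tot c d hne with h1 | h1
    · have := mono _ _ h1; omega
    · exact hn h1

theorem sim_mono {E E' : C → ℕ} (h : Sim col E E') {c d : C} (hl : slt col E' d c) :
    E d ≤ E c := by
  have h1 := h c d
  have h2 := h d c
  unfold slt at hl
  omega

/-- For a filling weakly increasing along `pos`. -/
theorem lt_iff_pos {pos E : C → ℕ} (hi : Function.Injective pos)
    (hb : ∀ c, pos c < Fintype.card C) (hm : ∀ c d, pos d < pos c → E d ≤ E c) (c : C) (k : ℕ) :
    E c < k ↔ pos c < Fintype.card {d // E d < k} := by
  constructor
  · intro h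
    have h1 := card_pos_lt hi hb (B := pos c + 1) (hb c)
    have : Fintype.card {d // pos d < pos c + 1} ≤ Fintype.card {d // E d < k} := by
      apply Fintype.card_subtype_mono
      intro d hd
      rcases Nat.lt_succ_iff_lt_or_eq.1 hd with h2 | h2
      · exact lt_of_le_of_lt (hm c d h2) h
      · rw [hi h2]; exact h
    omega
  · intro h
    by_contra hn
    have h1 := card_pos_lt hi hb (B := pos c) (hb c).le
    have : Fintype.card {d // E d < k} ≤ Fintype.card {d // pos d < pos c} := by
      apply Fintype.card_subtype_mono
      intro d hd
      change E d < k at hd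
      change pos d < pos c
      by_contra h2
      rcases Nat.lt_or_ge (pos c) (pos d) with h3 | h3
      · have := hm d c h3; omega
      · have : d = c := hi (by omega)
        subst this; omega
    omega

theorem iq_strict {E E' : C → ℕ} (hI : IQ col E') (h : Sim col E E')
    {p q : C} (hpq : E' p < E' q) : E p < E q := by
  classical
  obtain ⟨c, d, hc, hd, hcd⟩ := hI (E' p) ⟨q, hpq⟩
  -- leftmost cell with label `m`
  have hne : (Finset.univ.filter (fun x => E' x = E' p)).Nonempty := ⟨c, by simpa using hc⟩
  obtain ⟨c0, hc0, hmin⟩ := Finset.exists_min_image _ col hne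
  have hne' : (Finset.univ.filter (fun x => E' x = E' p + 1)).Nonempty := ⟨d, by simpa using hd⟩
  obtain ⟨d0, hd0, hmax⟩ := Finset.exists_max_image _ col hne'
  simp at hc0 hmin hd0 hmax
  have k1 := hmin c hc
  have k2 := hmax d hd
  have k0 := hmin p rfl
  have e1 : E p ≤ E c0 := (h c0 p k0).2 (by omega)
  have e2 : E c0 < E d0 := by
    have := h c0 d0 (by omega)
    omega
  have e3 : E d0 ≤ E q := by
    rcases Nat.lt_or_ge (E' p + 1) (E' q) with h3 | h3
    · apply sim_mono h
      left; omega
    · have := hmax q (by omega)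
      exact (h q d0 this).2 (by omega)
  omega

theorem iq_unique {E E' : C → ℕ} (hE : IQ col E) (hE' : IQ col E') (h : Sim col E E') :
    E = E' := by
  have key : ∀ {E E' : C → ℕ}, IQ col E → IQ col E' → Sim col E E' → ∀ m c, E c = m → m ≤ E' c := by
    intro E E' hE hE' h m
    induction m with
    | zero => intros; omega
    | succ m ih =>
      intro c hc
      obtain ⟨d, _, hd, -⟩ := hE m ⟨c, by omega⟩
      have h1 := ih d hd
      have := iq_strict hE h.symm (p := d) (q := c) (by omega)
      omega
  funext c
  exact le_antisymm (key hE hE' h _ c rfl) (key hE' hE h.symm _ c rfl)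

theorem iq_exists {n : ℕ} (E : C → ℕ) (hb : ∀ c, E c < n) :
    ∃ E', Sim col E E' ∧ IQ col E' ∧ ∀ c, E' c < n := by
  classical
  have hex : ∃ s, ∃ E' : C → ℕ, (Sim col E E' ∧ ∀ c, E' c < n) ∧ ∑ c, E' c = s :=
    ⟨_, E, ⟨fun _ _ _ => Iff.rfl, hb⟩, rfl⟩
  obtain ⟨E', ⟨hs, hb'⟩, hsum⟩ := Nat.find_spec hex
  have hmin := fun m => @Nat.find_min _ _ hex m
  refine ⟨E', hs, ?_, hb'⟩
  intro m ⟨c0, hc0⟩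
  by_contra hno
  push Not at hno
  refine hmin (∑ c, (if E' c ≤ m then E' c else E' c - 1)) ?_
    ⟨fun c => if E' c ≤ m then E' c else E' c - 1, ⟨hs.trans ?_, ?_⟩, rfl⟩
  · rw [← hsum]
    apply Finset.sum_lt_sum
    · intro c _; split_ifs <;> omega
    · refine ⟨c0, by simp, ?_⟩
      rw [if_neg (by omega)]; omega
  · intro c d hcd
    have := hno c d
    dsimp only
    split_ifs <;> omega
  · intro c
    have := hb' c
    dsimp only
    split_ifs <;> omega

/-- weight of a filling -/
noncomputable def wtC (n : ℕ) (E : C → ℕ) (k : Fin n) : ℕ := Fintype.card {c // E c = (k : ℕ)}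

theorem cum_wtC {n : ℕ} {E : C → ℕ} (hb : ∀ c, E c < n) (k : ℕ) :
    cum (wtC n E) k = Fintype.card {c // E c < k} := by
  classical
  simp only [cum, wtC, Fintype.card_subtype]
  rw [Finset.card_eq_sum_card_fiberwise (f := fun c => (⟨E c, hb c⟩ : Fin n))
    (t := Finset.univ.filter (fun i : Fin n => (i : ℕ) < k))]
  · apply Finset.sum_congr rfl
    intro i hi
    congr 1
    ext c
    simp [Fin.ext_iff] at hi ⊢
    omega
  · intro c hc
    simpa using hc

theorem sum_eq_cum {n : ℕ} (b : Fin n → ℕ) : ∑ i, b i = cum b n := by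
  simp [cum]

theorem sum_wtC {n : ℕ} {E : C → ℕ} (hb : ∀ c, E c < n) : ∑ i, wtC n E i = Fintype.card C := by
  rw [sum_eq_cum, cum_wtC hb]
  exact Fintype.card_of_bijective (f := Subtype.val)
    ⟨Subtype.val_injective, fun c => ⟨⟨c, hb c⟩, rfl⟩⟩

theorem cum_succ {n : ℕ} (b : Fin n → ℕ) (k : Fin n) : cum b (k + 1) = cum b k + b k := by
  unfold cum
  have : (Finset.univ.filter (fun i : Fin n => (i : ℕ) < k + 1)) =
      insert k (Finset.univ.filter (fun i : Fin n => (i : ℕ) < k)) := by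
    ext i; simp [Fin.ext_iff]; omega
  rw [this, Finset.sum_insert (by simp)]
  omega

theorem cum_mono {n : ℕ} (b : Fin n → ℕ) : Monotone (cum b) := by
  intro k l h
  apply Finset.sum_le_sum_of_subset
  intro i hi
  simp at hi ⊢
  omega

theorem wtC_inj {n : ℕ} {E1 E2 E' : C → ℕ} (hE' : CInj col E') (h1 : Sim col E1 E')
    (h2 : Sim col E2 E') (b1 : ∀ c, E1 c < n) (b2 : ∀ c, E2 c < n)
    (hw : wtC n E1 = wtC n E2) : E1 = E2 := by
  obtain ⟨pos, hi, hb, hp⟩ := exists_pos hE'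
  funext c
  have e : ∀ k, E1 c < k ↔ E2 c < k := by
    intro k
    rw [lt_iff_pos hi hb (fun c d h => sim_mono h1 ((hp c d).1 h)),
      lt_iff_pos hi hb (fun c d h => sim_mono h2 ((hp c d).1 h)), ← cum_wtC b1, ← cum_wtC b2, hw]
  have := e (E1 c)
  have := e (E2 c)
  omega

theorem wtC_refines {n : ℕ} {E E' : C → ℕ} (hI : IQ col E') (h : Sim col E E')
    (b : ∀ c, E c < n) (b' : ∀ c, E' c < n) :
    Refines (posPart (wtC n E)) (posPart (wtC n E')) := by
  classical
  rw [refines_iff, sum_wtC b, sum_wtC b']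
  refine ⟨rfl, fun m => ?_⟩
  simp only [cum_wtC b, cum_wtC b']
  refine ⟨(Finset.univ.filter (fun c => E' c < m)).sup (fun c => E c + 1), ?_⟩
  apply Fintype.card_congr
  apply Equiv.subtypeEquivRight
  intro c
  constructor
  · intro hc
    rw [Finset.lt_sup_iff] at hc
    obtain ⟨d, hd, hcd⟩ := hc
    simp at hd
    by_contra hn
    have := iq_strict hI h (p := d) (q := c) (by omega)
    omega
  · intro hc
    rw [Finset.lt_sup_iff]
    exact ⟨c, by simpa using hc, by omega⟩

theorem wtC_surj {n : ℕ} {E' : C → ℕ} (hE' : CInj col E')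
    (b' : ∀ c, E' c < n) (b : Fin n → ℕ) (hr : Refines (posPart b) (posPart (wtC n E'))) :
    ∃ E : C → ℕ, Sim col E E' ∧ (∀ c, E c < n) ∧ wtC n E = b := by
  classical
  obtain ⟨pos, hi, hb, hp⟩ := exists_pos hE'
  rw [refines_iff, sum_wtC b'] at hr
  obtain ⟨hs, hr⟩ := hr
  simp only [cum_wtC b'] at hr
  have hex : ∀ c, ∃ k, pos c < cum b (k + 1) := by
    intro c
    refine ⟨n, lt_of_lt_of_le (hb c) ?_⟩
    rw [← hs, sum_eq_cum]
    exact cum_mono b (by omega)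
  have c0 : cum b 0 = 0 := by simp [cum]
  have hlt : ∀ c k, Nat.find (hex c) < k ↔ pos c < cum b k := by
    intro c k
    rw [Nat.find_lt_iff]
    constructor
    · rintro ⟨m, hm, h⟩
      exact lt_of_lt_of_le h (cum_mono b hm)
    · intro h
      cases k with
      | zero => omega
      | succ k => exact ⟨k, by omega, h⟩
  have hbd : ∀ c, Nat.find (hex c) < n := by
    intro c
    rw [hlt, ← sum_eq_cum, hs]
    exact hb c
  refine ⟨fun c => Nat.find (hex c), ?_, hbd, ?_⟩
  · have mono : ∀ c d, pos d ≤ pos c → Nat.find (hex d) ≤ Nat.find (hex c) := by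
      intro c d h
      apply Nat.find_mono
      intro k hk
      omega
    have m' : ∀ c d, pos d < pos c → E' d ≤ E' c := fun c d h => by
      have := (hp c d).1 h
      unfold slt at this; omega
    intro c d hcd
    constructor
    · intro h
      by_contra hn
      obtain ⟨k, hk⟩ := hr (E' c + 1)
      have h1 := (lt_iff_pos hi hb m' c (E' c + 1)).1 (by omega)
      have h2 := mt (lt_iff_pos hi hb m' d (E' c + 1)).2 (by omega)
      rw [← hk, ← hlt] at h1 h2
      dsimp only at h
      omega
    · intro h
      apply mono
      by_contra hn
      have := (hp d c).1 (by omega)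
      unfold slt at this
      omega
  · have hc : ∀ k, k ≤ n → cum (wtC n fun c => Nat.find (hex c)) k = cum b k := by
      intro k hk
      rw [cum_wtC hbd]
      have hB : cum b k ≤ Fintype.card C := by
        rw [← hs, sum_eq_cum]; exact cum_mono b hk
      rw [← card_pos_lt hi hb hB]
      apply Fintype.card_congr
      apply Equiv.subtypeEquivRight
      intro c
      exact hlt c k
    funext k
    have h1 := hc k (by omega)
    have h2 := hc (k + 1) (by omega)
    rw [cum_succ, cum_succ] at h2
    omega

end core

/-! ### Tableaux of fixed strong composition shape -/

/-- cells of the diagram of a strong composition -/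
abbrev Cell {l : ℕ} (s : Fin l → ℕ) := Σ i : Fin l, Fin (s i)

/-- column of a cell -/
def ccol {l : ℕ} {s : Fin l → ℕ} (c : Cell s) : ℕ := c.2.val

/-- composition tableaux of shape `s` with labels in `[0, n)` -/
structure Valid {l : ℕ} (s : Fin l → ℕ) (n : ℕ) (E : Cell s → ℕ) : Prop where
  bound : ∀ c, E c < n
  cinj : CInj ccol E
  row : ∀ c d : Cell s, c.1 = d.1 → ccol c ≤ ccol d → E d ≤ E c
  triple1 : ∀ z x y : Cell s, z.1 = x.1 → ccol x = ccol z + 1 → ccol y = ccol x →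
    x.1 < y.1 → s y.1 ≤ s x.1 → ¬ (E x ≤ E y ∧ E y ≤ E z)
  triple2 : ∀ z x y : Cell s, z.1 = x.1 → ccol x = ccol z + 1 → ccol y = ccol x →
    y.1 < x.1 → s y.1 < s x.1 → ¬ (E x ≤ E y ∧ E y ≤ E z)
  first : ∀ c d : Cell s, ccol c = 0 → ccol d = 0 → c.1 < d.1 → E c < E d

theorem Valid.of_sim {l : ℕ} {s : Fin l → ℕ} {n : ℕ} {E E' : Cell s → ℕ} (h : Valid s n E)
    (hs : Sim ccol E E') (hb : ∀ c, E' c < n) : Valid s n E' where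
  bound := hb
  cinj c d hne hc := by
    have := h.cinj c d hne hc
    have h1 := hs c d hc.le
    have h2 := hs d c hc.ge
    omega
  row c d h1 h2 := (hs c d h2).1 (h.row c d h1 h2)
  triple1 z x y h1 h2 h3 h4 h5 := by
    rw [← hs y x (by omega), ← hs z y (by omega)]
    exact h.triple1 z x y h1 h2 h3 h4 h5
  triple2 z x y h1 h2 h3 h4 h5 := by
    rw [← hs y x (by omega), ← hs z y (by omega)]
    exact h.triple2 z x y h1 h2 h3 h4 h5
  first c d h1 h2 h3 := by
    have := h.first c d h1 h2 h3
    have := hs c d (by omega)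
    omega

/-- positions of the nonempty rows -/
structure Pos {l n : ℕ} (s : Fin l → ℕ) (a : Fin n → ℕ) (r : Fin l → Fin n) : Prop where
  mono : StrictMono r
  val : ∀ i, a (r i) = s i
  off : ∀ k, a k ≠ 0 → ∃ i, r i = k

theorem Pos.posPart_eq {l n : ℕ} {s : Fin l → ℕ} {a : Fin n → ℕ} {r : Fin l → Fin n}
    (h : Pos s a r) (hs : ∀ i, 0 < s i) : posPart a = List.ofFn s := by
  unfold _root_.posPart
  have h1 : (List.finRange n).filter (fun k => a k ≠ 0) = List.ofFn r := by
    apply List.Pairwise.eq_of_mem_iff (r := (· < ·))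
    · exact (List.pairwise_lt_finRange n).filter _
    · rw [List.pairwise_ofFn]
      intro i j hij; exact h.mono hij
    · intro k
      simp only [List.mem_filter, List.mem_finRange, true_and, List.mem_ofFn, decide_eq_true_eq]
      constructor
      · exact h.off k
      · rintro ⟨i, rfl⟩
        rw [h.val]; exact (hs i).ne'
  rw [List.ofFn_eq_map, List.filter_map]
  change List.map a ((List.finRange n).filter (fun k => a k ≠ 0)) = _
  rw [h1, List.map_ofFn]
  congr 1
  funext i; exact h.val i

theorem exists_pos_rows {n : ℕ} (a : Fin n → ℕ) : ∃ r, Pos (posPart a).get a r := by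
  have h0 : posPart a = ((List.finRange n).filter (fun k => a k ≠ 0)).map a := by
    unfold _root_.posPart
    rw [List.ofFn_eq_map, List.filter_map]; rfl
  have hp : ((List.finRange n).filter (fun k => a k ≠ 0)).Pairwise (· < ·) :=
    (List.pairwise_lt_finRange n).filter _
  rw [h0]
  generalize hL : (List.finRange n).filter (fun k => a k ≠ 0) = L at hp
  refine ⟨fun i => L.get (i.cast (by simp)), ?_, ?_, ?_⟩
  · intro i j hij
    exact List.pairwise_iff_get.1 hp _ _ (by simpa using hij)
  · intro i; simp
  · intro k hk
    have : k ∈ L := by rw [← hL]; simpa using hk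
    obtain ⟨i, hi⟩ := List.mem_iff_get.1 this
    exact ⟨i.cast (by simp), by simpa using hi⟩

/-- correspondence between `ASSF` and valid fillings -/
structure Rel {l n : ℕ} {s : Fin l → ℕ} {a : Fin n → ℕ} (T : ASSF n a) (E : Cell s → ℕ)
    (r : Fin l → Fin n) : Prop extends Pos s a r where
  ent : ∀ c : Cell s, T.entry (r c.1) c.2 = E c + 1

theorem Pos.cell {l n : ℕ} {s : Fin l → ℕ} {a : Fin n → ℕ} {r : Fin l → Fin n}
    (h : Pos s a r) {k : Fin n} {j : ℕ} (hj : j < a k) :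
    ∃ c : Cell s, r c.1 = k ∧ ccol c = j := by
  obtain ⟨i, rfl⟩ := h.off k (by omega)
  exact ⟨⟨i, ⟨j, by rw [← h.val]; exact hj⟩⟩, rfl, rfl⟩

theorem Pos.lt {l n : ℕ} {s : Fin l → ℕ} {a : Fin n → ℕ} {r : Fin l → Fin n}
    (h : Pos s a r) (c : Cell s) : ccol c < a (r c.1) := by
  rw [h.val]; exact c.2.2

theorem rel_exists {l n : ℕ} {s : Fin l → ℕ} {a : Fin n → ℕ} (T : ASSF n a)
    {r : Fin l → Fin n} (h : Pos s a r) : ∃ E : Cell s → ℕ, Valid s n E ∧ Rel T E r := by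
  let E : Cell s → ℕ := fun c => T.entry (r c.1) (ccol c) - 1
  have hE : ∀ c : Cell s, T.entry (r c.1) (ccol c) = E c + 1 := by
    intro c
    have := T.pos _ _ (h.lt c)
    simp only [E]; omega
  refine ⟨E, ?_, h, hE⟩
  constructor
  · intro c
    have h1 := T.rowWeak (r c.1) 0 (ccol c) (by omega) (h.lt c)
    have h2 := T.firstCol (r c.1) (by have := h.lt c; omega)
    have h3 := hE c
    have := (r c.1).2
    omega
  · intro c d hne hc
    have h1 : c.1 ≠ d.1 := by
      intro h1
      apply hne
      obtain ⟨i, j⟩ := c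
      obtain ⟨i', j'⟩ := d
      obtain rfl : i = i' := h1
      obtain rfl : j = j' := Fin.ext hc
      rfl
    have h2 := T.colDistinct (r c.1) (r d.1) (ccol c) (fun h' => h1 (h.mono.injective h'))
      (h.lt c) (by rw [hc]; exact h.lt d)
    have h3 := hE c
    have h4 := hE d
    rw [← hc] at h4
    omega
  · intro c d h1 h2
    have h3 := T.rowWeak (r d.1) (ccol c) (ccol d) h2 (h.lt d)
    have h4 := hE c
    have h5 := hE d
    rw [h1] at h4
    omega
  · intro z x y h1 h2 h3 h4 h5
    have h6 := T.triple1 (r x.1) (r y.1) (ccol z) (h.mono h4) (by rwa [h.val, h.val])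
      (by rw [← h2]; exact h.lt x) (by rw [← h2, ← h3]; exact h.lt y)
    have ez := hE z
    have ex := hE x
    have ey := hE y
    rw [h1] at ez
    rw [h2] at ex
    rw [h3, h2] at ey
    omega
  · intro z x y h1 h2 h3 h4 h5
    have h6 := T.triple2 (r x.1) (r y.1) (ccol z) (h.mono h4) (by rwa [h.val, h.val])
      (by rw [← h2]; exact h.lt x) (by rw [← h2, ← h3]; exact h.lt y)
    have ez := hE z
    have ex := hE x
    have ey := hE y
    rw [h1] at ez
    rw [h2] at ex
    rw [h3, h2] at ey
    omega
  · intro c d h1 h2 h3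
    have e1 := hE c
    have e2 := hE d
    have l1 := h.lt c
    have l2 := h.lt d
    rw [h1] at e1 l1
    rw [h2] at e2 l2
    rw [T.firstCol _ l1] at e1
    rw [T.firstCol _ l2] at e2
    have : (r c.1 : ℕ) < r d.1 := h.mono h3
    omega

theorem rel_unique_right {l n : ℕ} {s : Fin l → ℕ} {a : Fin n → ℕ} (hs : ∀ i, 0 < s i)
    {T : ASSF n a} {E E' : Cell s → ℕ} {r r' : Fin l → Fin n} (h : Rel T E r) (h' : Rel T E' r') :
    E = E' := by
  have hr : r = r' := by
    rw [← StrictMono.range_inj h.mono h'.mono]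
    have key : ∀ {r : Fin l → Fin n}, Pos s a r → Set.range r = {k | a k ≠ 0} := by
      intro r h
      ext k
      constructor
      · rintro ⟨i, rfl⟩
        have := hs i
        rw [Set.mem_setOf_eq, h.val]; omega
      · exact h.off k
    rw [key h.toPos, key h'.toPos]
  subst hr
  funext c
  have h1 := h.ent c
  have h2 := h'.ent c
  omega

theorem rel_row {l n : ℕ} {s : Fin l → ℕ} {a : Fin n → ℕ} (hs : ∀ i, 0 < s i)
    {T : ASSF n a} {E : Cell s → ℕ} {r : Fin l → Fin n} (h : Rel T E r) (i : Fin l) :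
    (r i : ℕ) = E ⟨i, ⟨0, hs i⟩⟩ := by
  have h1 := h.ent ⟨i, ⟨0, hs i⟩⟩
  have h2 := T.firstCol (r i) (by rw [h.val]; exact hs i)
  simp only at h1
  omega

theorem assf_ext {n : ℕ} {a : Fin n → ℕ} {T T' : ASSF n a} (h : T.entry = T'.entry) : T = T' := by
  cases T; cases T'; cases h; rfl

theorem rel_unique_left {l n : ℕ} {s : Fin l → ℕ} {a a' : Fin n → ℕ} (hs : ∀ i, 0 < s i)
    {T : ASSF n a} {T' : ASSF n a'} {E : Cell s → ℕ} {r r' : Fin l → Fin n} (h : Rel T E r)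
    (h' : Rel T' E r') : (⟨a, T⟩ : Σ a, ASSF n a) = ⟨a', T'⟩ := by
  obtain rfl : r = r' := by
    funext i
    apply Fin.ext
    rw [rel_row hs h, rel_row hs h']
  obtain rfl : a = a' := by
    funext k
    by_cases h1 : ∃ i, r i = k
    · obtain ⟨i, rfl⟩ := h1
      rw [h.val, h'.val]
    · have e1 := mt (h.off k) h1
      have e2 := mt (h'.off k) h1
      omega
  congr 1
  apply assf_ext
  funext k j
  by_cases hj : j < a k
  · obtain ⟨c, rfl, rfl⟩ := h.cell hj
    exact (h.ent c).trans (h'.ent c).symm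
  · rw [T.zero _ _ hj, T'.zero _ _ hj]

theorem rel_surj {l n : ℕ} {s : Fin l → ℕ} (hs : ∀ i, 0 < s i) {E : Cell s → ℕ}
    (hE : Valid s n E) : ∃ (a : Fin n → ℕ) (T : ASSF n a) (r : Fin l → Fin n), Rel T E r := by
  classical
  let r : Fin l → Fin n := fun i => ⟨E ⟨i, ⟨0, hs i⟩⟩, hE.bound _⟩
  have hr : StrictMono r := by
    intro i j hij
    exact hE.first _ _ rfl rfl hij
  let a : Fin n → ℕ := fun k => if h : ∃ i, r i = k then s h.choose else 0
  have ha : ∀ i, a (r i) = s i := by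
    intro i
    have hx : ∃ j, r j = r i := ⟨i, rfl⟩
    simp only [a]
    rw [dif_pos hx, hr.injective hx.choose_spec]
  have hP : Pos s a r := by
    refine ⟨hr, ha, ?_⟩
    intro k hk
    by_contra hn
    exact hk (dif_neg hn)
  let e : Fin n → ℕ → ℕ := fun k j =>
    if h : ∃ c : Cell s, r c.1 = k ∧ ccol c = j then E h.choose + 1 else 0
  have he : ∀ c : Cell s, e (r c.1) (ccol c) = E c + 1 := by
    intro c
    have hx : ∃ d : Cell s, r d.1 = r c.1 ∧ ccol d = ccol c := ⟨c, rfl, rfl⟩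
    simp only [e]
    rw [dif_pos hx]
    obtain ⟨h1, h2⟩ := hx.choose_spec
    have : hx.choose = c := by
      generalize hx.choose = d at h1 h2
      have h1 := hr.injective h1
      obtain ⟨i, j⟩ := c
      obtain ⟨i', j'⟩ := d
      obtain rfl : i' = i := h1
      obtain rfl : j' = j := Fin.ext h2
      rfl
    rw [this]
  refine ⟨a, ⟨e, ?_, ?_, ?_, ?_, ?_, ?_, ?_⟩, r, hP, he⟩
  · intro k j hj
    obtain ⟨c, rfl, rfl⟩ := hP.cell hj
    rw [he]; omega
  · intro k j hj
    apply dif_neg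
    rintro ⟨c, rfl, rfl⟩
    exact hj (hP.lt c)
  · intro k k' j hk h1 h2
    obtain ⟨c, rfl, rfl⟩ := hP.cell h1
    obtain ⟨d, rfl, hd⟩ := hP.cell h2
    have := hE.cinj c d (by rintro rfl; exact hk rfl) hd.symm
    rw [he, ← hd, he]
    omega
  · intro k j j' hjj h1
    obtain ⟨c, rfl, rfl⟩ := hP.cell h1
    obtain ⟨d, hd1, rfl⟩ := hP.cell (lt_of_le_of_lt hjj h1)
    have := hE.row d c (hr.injective hd1) hjj
    rw [he, ← hd1, he]
    omega
  · intro k k' j hk hak h1 h2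
    obtain ⟨x, rfl, hx⟩ := hP.cell h1
    obtain ⟨y, rfl, hy⟩ := hP.cell h2
    obtain ⟨z, hz, rfl⟩ := hP.cell (show j < a (r x.1) by omega)
    have := hE.triple1 z x y (hr.injective hz) hx (by omega) (hr.lt_iff_lt.1 hk)
      (by rwa [ha, ha] at hak)
    rw [← hx, he, ← hz, he, hx, ← hy, he]
    omega
  · intro k k' j hk hak h1 h2
    obtain ⟨x, rfl, hx⟩ := hP.cell h1
    obtain ⟨y, rfl, hy⟩ := hP.cell h2
    obtain ⟨z, hz, rfl⟩ := hP.cell (show j < a (r x.1) by omega)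
    have := hE.triple2 z x y (hr.injective hz) hx (by omega) (hr.lt_iff_lt.1 hk)
      (by rwa [ha, ha] at hak)
    rw [← hx, he, ← hz, he, hx, ← hy, he]
    omega
  · intro k hk
    obtain ⟨c, rfl, hc⟩ := hP.cell hk
    rw [← hc, he]
    obtain ⟨i, j⟩ := c
    obtain rfl : j = ⟨0, hs i⟩ := Fin.ext hc
    rfl

theorem rel_wt {l n : ℕ} {s : Fin l → ℕ} {a : Fin n → ℕ}
    {T : ASSF n a} {E : Cell s → ℕ} {r : Fin l → Fin n} (h : Rel T E r) : T.wt = wtC n E := by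
  classical
  funext k
  unfold ASSF.wt wtC
  have hset : {p : Fin n × ℕ | p.2 < a p.1 ∧ T.entry p.1 p.2 = (k : ℕ) + 1} =
      (fun c : Cell s => (r c.1, ccol c)) '' {c | E c = (k : ℕ)} := by
    ext ⟨i, j⟩
    simp only [Set.mem_setOf_eq, Set.mem_image, Prod.mk.injEq]
    constructor
    · rintro ⟨h1, h2⟩
      obtain ⟨c, rfl, rfl⟩ := h.cell h1
      have := h.ent c
      refine ⟨c, ?_, rfl, rfl⟩
      unfold ccol at h2
      omega
    · rintro ⟨c, hc, rfl, rfl⟩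
      refine ⟨h.lt c, ?_⟩
      rw [← hc]; exact h.ent c
  rw [hset, Set.ncard_image_of_injective]
  · rw [← Nat.card_coe_set_eq, Nat.card_eq_fintype_card]
    rfl
  · intro c d hcd
    simp only [Prod.mk.injEq] at hcd
    obtain ⟨h1, h2⟩ := hcd
    have h1 := h.mono.injective h1
    obtain ⟨i, j⟩ := c
    obtain ⟨i', j'⟩ := d
    obtain rfl : i = i' := h1
    obtain rfl : j = j' := Fin.ext h2
    rfl

theorem rel_appears {l n : ℕ} {s : Fin l → ℕ} {a : Fin n → ℕ}
    {T : ASSF n a} {E : Cell s → ℕ} {r : Fin l → Fin n} (h : Rel T E r) (m : ℕ) :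
    T.Appears m ↔ ∃ c, E c + 1 = m := by
  constructor
  · rintro ⟨i, j, hj, rfl⟩
    obtain ⟨c, rfl, rfl⟩ := h.cell hj
    exact ⟨c, (h.ent c).symm⟩
  · rintro ⟨c, rfl⟩
    exact ⟨_, _, h.lt c, h.ent c⟩

theorem rel_iq {l n : ℕ} {s : Fin l → ℕ} {a : Fin n → ℕ} (hs : ∀ i, 0 < s i)
    {T : ASSF n a} {E : Cell s → ℕ} {r : Fin l → Fin n} (h : Rel T E r) (hE : Valid s n E) :
    (T.QuasiYam ∧ T.Initial) ↔ IQ ccol E := by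
  have ent : ∀ c : Cell s, T.entry (r c.1) (ccol c) = E c + 1 := h.ent
  constructor
  · rintro ⟨hq, hi⟩
    have down : ∀ t m, (∃ c, E c = m + t) → ∃ c, E c = m := by
      intro t
      induction t with
      | zero => intro m h; exact h
      | succ t ih =>
        rintro m ⟨c, hc⟩
        apply ih
        have := hi (m + t + 1) (by omega) ((rel_appears h _).2 ⟨c, by omega⟩)
        obtain ⟨d, hd⟩ := (rel_appears h _).1 this
        exact ⟨d, by omega⟩
    rintro m ⟨c, hc⟩
    obtain ⟨d, hd⟩ := down (E c - (m + 1)) (m + 1) ⟨c, by omega⟩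
    obtain ⟨c', hc'⟩ := down 1 m ⟨d, hd⟩
    rcases hq (m + 1) ((rel_appears h _).2 ⟨c', by omega⟩) with ⟨i, h1, h2⟩ |
      ⟨i, i', j, j', h1, h2, h3, h4, h5⟩
    · obtain ⟨x, rfl, hx⟩ := h.cell h1
      rw [← hx, ent] at h2
      exact ⟨x, d, by omega, hd, by omega⟩
    · obtain ⟨x, rfl, rfl⟩ := h.cell h1
      obtain ⟨y, rfl, rfl⟩ := h.cell h2
      rw [ent] at h4 h5
      exact ⟨x, y, by omega, by omega, h3⟩
  · intro hq
    constructor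
    · intro m hm
      obtain ⟨c, rfl⟩ := (rel_appears h _).1 hm
      by_cases hx : ∃ d, E c < E d
      · right
        obtain ⟨x, y, h1, h2, h3⟩ := hq _ hx
        exact ⟨_, _, _, _, h.lt x, h.lt y, h3, by rw [ent, h1], by rw [ent, h2]⟩
      · left
        push Not at hx
        let f : Cell s := ⟨c.1, ⟨0, hs c.1⟩⟩
        have h1 := hE.row f c rfl (Nat.zero_le _)
        have h2 := hx f
        refine ⟨r f.1, h.lt f, ?_⟩
        have := ent f
        change T.entry (r f.1) 0 = _ at this
        omega
    · intro m hm ha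
      obtain ⟨c, hc⟩ := (rel_appears h _).1 ha
      obtain ⟨x, _, h1, -⟩ := hq (m - 1) ⟨c, by omega⟩
      exact (rel_appears h _).2 ⟨x, by omega⟩

/-! ### Summation -/

instance valid_finite {l : ℕ} (s : Fin l → ℕ) (n : ℕ) : Finite {E : Cell s → ℕ // Valid s n E} :=
  Finite.of_injective (β := Cell s → Fin n) (fun E c => ⟨E.1 c, E.2.bound c⟩) (by
    intro E E' h
    apply Subtype.ext
    funext c
    simpa using congrFun h c)

theorem shape_finite (n : ℕ) (α : List ℕ) : Finite {a : Fin n → ℕ // posPart a = α} := by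
  apply Finite.of_injective (β := Fin n → Fin (α.sum + 1))
    (fun a i => ⟨a.1 i, by
      have h1 := posPart_sum a.1
      rw [a.2] at h1
      have := Finset.single_le_sum (f := a.1) (fun _ _ => Nat.zero_le _) (Finset.mem_univ i)
      omega⟩)
  intro a a' h
  apply Subtype.ext
  funext i
  simpa using congrFun h i

theorem sum_transfer {M : Type*} [AddCommMonoid M] (n : ℕ) (α : List ℕ) (hα : ∀ x ∈ α, 0 < x)
    (F : ∀ a : Fin n → ℕ, ASSF n a → M) (G : (Cell α.get → ℕ) → M)
    (hFG : ∀ a (T : ASSF n a) E r, Valid α.get n E → Rel T E r → F a T = G E) :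
    ∑ᶠ (a : Fin n → ℕ) (_ : posPart a = α), ∑ᶠ T : ASSF n a, F a T =
      ∑ᶠ E : {E : Cell α.get → ℕ // Valid α.get n E}, G E.1 := by
  classical
  have hs : ∀ i, 0 < α.get i := fun i => hα _ (List.get_mem _ _)
  have hex : ∀ x : (Σ a : {a : Fin n → ℕ // posPart a = α}, ASSF n a.1),
      ∃ E : {E : Cell α.get → ℕ // Valid α.get n E}, ∃ r, Rel x.2 E.1 r := by
    rintro ⟨⟨a, rfl⟩, T⟩
    obtain ⟨r, hr⟩ := exists_pos_rows a
    obtain ⟨E, h1, h2⟩ := rel_exists T hr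
    exact ⟨⟨E, h1⟩, r, h2⟩
  choose f hf using hex
  have finj : Function.Injective f := by
    rintro ⟨⟨a, ha⟩, T⟩ ⟨⟨a', ha'⟩, T'⟩ h
    obtain ⟨r, h1⟩ := hf ⟨⟨a, ha⟩, T⟩
    obtain ⟨r', h2⟩ := hf ⟨⟨a', ha'⟩, T'⟩
    rw [← h] at h2
    have := rel_unique_left hs h1 h2
    cases this
    rfl
  have fsurj : Function.Surjective f := by
    intro E
    obtain ⟨a, T, r, h⟩ := rel_surj hs E.2
    have ha : posPart a = α := by
      rw [h.toPos.posPart_eq hs, List.ofFn_get]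
    obtain ⟨r', h'⟩ := hf ⟨⟨a, ha⟩, T⟩
    exact ⟨⟨⟨a, ha⟩, T⟩, Subtype.ext (rel_unique_right hs h' h)⟩
  have hfin : Finite (Σ a : {a : Fin n → ℕ // posPart a = α}, ASSF n a.1) :=
    Finite.of_injective f finj
  have hfa := shape_finite n α
  have hft : ∀ a : {a : Fin n → ℕ // posPart a = α}, Finite (ASSF n a.1) := fun a =>
    Finite.of_injective (β := Σ a : {a : Fin n → ℕ // posPart a = α}, ASSF n a.1)
      (fun T => ⟨a, T⟩) (by intro T T' h; simpa using h)
  have e1 : ∑ᶠ (a : Fin n → ℕ) (_ : posPart a = α), ∑ᶠ T : ASSF n a, F a T =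
      ∑ᶠ a : {a : Fin n → ℕ // posPart a = α}, ∑ᶠ T : ASSF n a.1, F a.1 T :=
    (finsum_set_coe_eq_finsum_mem {a : Fin n → ℕ | posPart a = α}).symm
  rw [e1]
  letI := Fintype.ofFinite {a : Fin n → ℕ // posPart a = α}
  letI := fun a : {a : Fin n → ℕ // posPart a = α} => Fintype.ofFinite (ASSF n a.1)
  letI := Fintype.ofFinite {E : Cell α.get → ℕ // Valid α.get n E}
  simp only [finsum_eq_sum_of_fintype]
  rw [← Fintype.sum_sigma' (f := fun (a : {a : Fin n → ℕ // posPart a = α}) (T : ASSF n a.1) => F a.1 T)]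
  apply Fintype.sum_bijective f ⟨finj, fsurj⟩
  intro x
  obtain ⟨r, h⟩ := hf x
  exact hFG _ _ _ r (f x).2 h

theorem fq_eq {l : ℕ} {s : Fin l → ℕ} {n : ℕ} {E' : Cell s → ℕ} (h : Valid s n E')
    (hI : IQ ccol E') : Fq n (posPart (wtC n E')) =
      ∑ᶠ E ∈ {E : {E : Cell s → ℕ // Valid s n E} | Sim ccol E.1 E'}, xpow n (wtC n E.1) := by
  unfold Fq
  rw [← finsum_mem_image (g := fun E : {E : Cell s → ℕ // Valid s n E} => wtC n E.1)
    (f := fun b => xpow n b)]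
  · apply finsum_congr
    intro b
    refine finsum_congr_Prop (propext ?_) (fun _ => rfl)
    · constructor
      · intro hb
        obtain ⟨E, h1, h2, h3⟩ := wtC_surj h.cinj h.bound b hb
        exact ⟨⟨E, h.of_sim h1.symm h2⟩, h1, h3⟩
      · rintro ⟨E, h1, rfl⟩
        exact wtC_refines hI h1 E.2.bound h.bound
  · intro E1 h1 E2 h2 hw
    exact Subtype.ext (wtC_inj h.cinj h1 h2 E1.2.bound E2.2.bound hw)

theorem main_sum {l : ℕ} (s : Fin l → ℕ) (n : ℕ) :
    ∑ᶠ E : {E : Cell s → ℕ // Valid s n E}, xpow n (wtC n E.1) =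
      ∑ᶠ E : {E : Cell s → ℕ // Valid s n E}, ∑ᶠ (_ : IQ ccol E.1), Fq n (posPart (wtC n E.1)) := by
  classical
  letI := Fintype.ofFinite {E : Cell s → ℕ // Valid s n E}
  have hD : ∀ E : {E : Cell s → ℕ // Valid s n E}, ∃ E' : {E : Cell s → ℕ // Valid s n E},
      Sim ccol E.1 E'.1 ∧ IQ ccol E'.1 := by
    intro E
    obtain ⟨E', h1, h2, h3⟩ := iq_exists (col := ccol) E.1 E.2.bound
    exact ⟨⟨E', E.2.of_sim h1 h3⟩, h1, h2⟩
  choose D hD1 hD2 using hD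
  rw [finsum_eq_sum_of_fintype, finsum_eq_sum_of_fintype, ← Finset.sum_fiberwise Finset.univ D]
  apply Finset.sum_congr rfl
  intro E' _
  by_cases hI : IQ ccol E'.1
  · rw [finsum_eq_if, if_pos hI, fq_eq E'.2 hI]
    rw [finsum_mem_eq_finite_toFinset_sum _ (Set.toFinite _)]
    apply Finset.sum_congr _ (fun _ _ => rfl)
    ext E
    simp only [Finset.mem_filter, Finset.mem_univ, true_and, Set.Finite.mem_toFinset,
      Set.mem_setOf_eq]
    constructor
    · rintro rfl; exact hD1 E
    · intro h
      exact Subtype.ext (iq_unique (hD2 E) hI ((hD1 E).symm.trans h))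
  · rw [finsum_eq_if, if_neg hI]
    apply Finset.sum_eq_zero
    intro E hE
    simp at hE
    exact absurd (hE ▸ hD2 E) hI

end QS

/-- The quasiSchur polynomial expands positively in fundamental quasisymmetric
polynomials: `S_α(x_1,…,x_n) = ∑_T F_{wt(T)}(x_1,…,x_n)`, the sum over all initial
quasiYamanouchi semistandard composition tableaux `T ∈ ASSF(a)` for weak compositions `a`
of length `n` with `a⁺ = α`. -/
theorem quasiSchur_expands_in_fundamental (n : ℕ) (α : List ℕ) (hα : ∀ x ∈ α, 0 < x) :
    quasiSchur n α =
      ∑ᶠ (a : Fin n → ℕ) (_ : posPart a = α),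
        ∑ᶠ (T : ASSF n a) (_ : T.QuasiYam ∧ T.Initial), Fq n (posPart T.wt) := by
  have hs : ∀ i, 0 < α.get i := fun i => hα _ (List.get_mem _ _)
  unfold quasiSchur
  rw [QS.sum_transfer n α hα (fun a T => xpow n T.wt) (fun E => xpow n (QS.wtC n E))
      (fun a T E r _ h => by rw [QS.rel_wt h]),
    QS.sum_transfer n α hα
      (fun a T => ∑ᶠ (_ : T.QuasiYam ∧ T.Initial), Fq n (posPart T.wt))
      (fun E => ∑ᶠ (_ : QS.IQ QS.ccol E), Fq n (posPart (QS.wtC n E)))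
      (fun a T E r hE h => by
        rw [QS.rel_wt h]
        exact finsum_congr_Prop (propext (QS.rel_iq hs h hE)) (fun _ => rfl))]
  exact QS.main_sum _ _
end

section
/- (Billey–Jockusch–Stanley formula) For every permutation π, the Schubert polynomial satisfies 𝔖_π = ∑_{α ∈ Red(π)} ∑_{β ⟲ α} ∏_i x_{β_i}, where the outer sum is over all reduced words α of π and the inner sum is over all α-compatible sequences β. -/
open MvPolynomial

/-- The simple transposition `s_a ∈ S_n` exchanging (1-indexed) positions `a`, `a+1`;
the identity when `a` is out of range. -/
def simpleT (n : ℕ) (a : ℕ) : Equiv.Perm (Fin n) :=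
  if h : 0 < a ∧ a < n then
    Equiv.swap ⟨a - 1, lt_of_le_of_lt (Nat.sub_le a 1) h.2⟩ ⟨a, h.2⟩
  else 1

/-- The permutation `s_{i_1} s_{i_2} ⋯ s_{i_k}` associated to a word `α = i_1 i_2 ⋯ i_k`. -/
def wordProd (n : ℕ) (α : List ℕ) : Equiv.Perm (Fin n) :=
  (α.map (simpleT n)).prod

/-- `α` is a reduced word for `π ∈ S_n`: a word in the letters `1, …, n-1` of minimal
length whose product of simple transpositions is `π`. -/
def IsRedWord (n : ℕ) (π : Equiv.Perm (Fin n)) (α : List ℕ) : Prop :=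
  (∀ x ∈ α, 0 < x ∧ x < n) ∧ wordProd n α = π ∧
  ∀ γ : List ℕ, (∀ x ∈ γ, 0 < x ∧ x < n) → wordProd n γ = π → α.length ≤ γ.length

/-- `β` is an `α`-compatible sequence: (R.1) same length; (R.2) weakly increasing;
(R.3) `β_i ≤ α_i`; (R.4) `β` strictly increases wherever `α` does. -/
def IsCompatible (β α : List ℕ) : Prop :=
  β.length = α.length ∧ (∀ x ∈ β, 0 < x) ∧ List.Chain' (· ≤ ·) β ∧
  (∀ i, i < α.length → β.getD i 0 ≤ α.getD i 0) ∧
  (∀ i, i + 1 < α.length → α.getD i 0 < α.getD (i + 1) 0 → β.getD i 0 < β.getD (i + 1) 0)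

/-- `S` is the family of Schubert polynomials for `S_n` (in the 1-indexed variables
`x_1, …, x_n`, with position `i : Fin n` corresponding to `x_{i+1}`):
`S(w_0) = x_1^{n-1} x_2^{n-2} ⋯ x_n^0` for the longest permutation `w_0`, and whenever
`w(i) < w(i+1)`, `S w = ∂_i (S (w s_i))`, i.e.
`(x_i - x_{i+1}) ⬝ S w = S (w s_i) - s_i ⬝ S (w s_i)`. -/
def SchubertFamily (n : ℕ) (S : Equiv.Perm (Fin n) → MvPolynomial ℕ ℤ) : Prop :=
  S Fin.revPerm = (∏ i : Fin n, X ((i : ℕ) + 1) ^ (n - 1 - (i : ℕ))) ∧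
  ∀ (w : Equiv.Perm (Fin n)) (i : Fin n) (h : (i : ℕ) + 1 < n),
    w i < w ⟨(i : ℕ) + 1, h⟩ →
    (X ((i : ℕ) + 1) - X ((i : ℕ) + 2)) * S w =
      S (w * Equiv.swap i ⟨(i : ℕ) + 1, h⟩) -
        rename (Equiv.swap ((i : ℕ) + 1) ((i : ℕ) + 2))
          (S (w * Equiv.swap i ⟨(i : ℕ) + 1, h⟩))

section BJSAlg
variable {R E : Type*} [CommRing R] [Ring E] [Algebra R E]

/-- The relations of the nilCoxeter algebra. -/
structure NilRel (u : ℕ → E) : Prop where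
  sq : ∀ a, u a * u a = 0
  braid : ∀ a, u a * u (a+1) * u a = u (a+1) * u a * u (a+1)
  comm : ∀ a b, a + 2 ≤ b → u a * u b = u b * u a

/-- `h_a(x) = 1 + x u_a`. -/
def hFac (u : ℕ → E) (a : ℕ) (x : R) : E := 1 + x • u a

/-- `A_i(x) = h_{n-1}(x) ⋯ h_i(x)`. -/
def aFac (u : ℕ → E) (n i : ℕ) (x : R) : E :=
  ((List.range' i (n - i)).reverse.map (fun a => hFac u a x)).prod

/-- `A_1(y_1) A_2(y_2) ⋯ A_n(y_n)`. -/
def fullProd (u : ℕ → E) (n : ℕ) (y : ℕ → R) : E :=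
  ((List.range' 1 n).map (fun b => aFac u n b (y b))).prod

theorem hFac_mul {u : ℕ → E} (hu : NilRel u) (a : ℕ) (x y : R) :
    hFac u a x * hFac u a y = hFac u a (x + y) := by
  simp only [hFac, mul_add, add_mul, smul_mul_assoc, mul_smul_comm, one_mul, mul_one,
    hu.sq, smul_zero]
  module

theorem hFac_zero (u : ℕ → E) (a : ℕ) : hFac u a (0 : R) = 1 := by simp [hFac]

theorem hFac_yb {u : ℕ → E} (hu : NilRel u) (a : ℕ) (x y : R) :
    hFac u a x * hFac u (a+1) y * hFac u a (y - x)
      = hFac u (a+1) (y - x) * hFac u a y * hFac u (a+1) x := by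
  simp only [hFac, mul_add, add_mul, smul_mul_assoc, mul_smul_comm, smul_smul, one_mul, mul_one,
    hu.sq, smul_zero, smul_add, hu.braid]
  module

theorem hFac_comm {u : ℕ → E} (hu : NilRel u) (a b : ℕ) (hab : a + 2 ≤ b) (x y : R) :
    Commute (hFac u a x) (hFac u b y) := by
  have : Commute (u a) (u b) := hu.comm a b hab
  unfold hFac
  exact ((Commute.one_left _).add_left
    (((Commute.one_right _).add_right (this.smul_right y)).smul_left x))

theorem aFac_top (u : ℕ → E) (n i : ℕ) (h : n ≤ i) (x : R) : aFac u n i x = 1 := by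
  simp [aFac, Nat.sub_eq_zero_of_le h]

theorem aFac_step (u : ℕ → E) (n i : ℕ) (h : i < n) (x : R) :
    aFac u n i x = aFac u n (i+1) x * hFac u i x := by
  unfold aFac
  obtain ⟨k, rfl⟩ : ∃ k, n = i + 1 + k := ⟨n - (i+1), by omega⟩
  have h1 : i + 1 + k - i = k + 1 := by omega
  have h2 : i + 1 + k - (i + 1) = k := by omega
  rw [h1, h2, List.range'_succ]
  simp

theorem aFac_commute_right {u : ℕ → E} (n i : ℕ) (x : R) (e : E)
    (he : ∀ b, i ≤ b → Commute e (hFac u b x)) : Commute e (aFac u n i x) := by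
  unfold aFac
  apply Commute.list_prod_right
  intro z hz
  simp only [List.mem_map, List.mem_reverse, List.mem_range'_1] at hz
  obtain ⟨b, hb, rfl⟩ := hz
  exact he b hb.1

theorem aFac_comm {u : ℕ → E} (hu : NilRel u) (n : ℕ) (k : ℕ) : ∀ (i : ℕ), n - i = k → ∀ (x y : R),
    aFac u n i x * aFac u n i y = aFac u n i y * aFac u n i x := by
  induction k with
  | zero =>
    intro i hi x y
    rw [aFac_top u n i (by omega), aFac_top u n i (by omega)]
  | succ k ih =>
    intro i hi x y
    have hin : i < n := by omega
    rcases Nat.lt_or_ge (i+1) n with h1 | h1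
    · have IH := ih (i+1) (by omega) x y
      have c : ∀ s t : R, hFac u i s * aFac u n (i+2) t = aFac u n (i+2) t * hFac u i s :=
        fun s t => aFac_commute_right n (i+2) t _ (fun b hb => hFac_comm hu i b hb s t)
      have s1 : ∀ s : R, aFac u n (i+1) s = aFac u n (i+2) s * hFac u (i+1) s :=
        fun s => aFac_step u n (i+1) h1 s
      have s2 : ∀ s t : R, aFac u n (i+2) s * hFac u (i+1) (s - t)
          = aFac u n (i+1) s * hFac u (i+1) (-t) := by
        intro s t
        rw [s1, mul_assoc, hFac_mul hu, sub_eq_add_neg]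
      have s3 : aFac u n (i+1) x * hFac u (i+1) (-x) = aFac u n (i+2) x := by
        rw [← s2, sub_self, hFac_zero, mul_one]
      have s4 : hFac u i x * hFac u (i+1) y * hFac u i y =
          hFac u (i+1) (y - x) * hFac u i y * hFac u (i+1) x * hFac u i x := by
        rw [← hFac_yb hu, mul_assoc _ (hFac u i (y-x)), hFac_mul hu]
        simp
      calc aFac u n i x * aFac u n i y
          = aFac u n (i+1) x * (hFac u i x * aFac u n (i+2) y) * hFac u (i+1) y * hFac u i y := by
            rw [aFac_step u n i hin x, aFac_step u n i hin y, s1 y]; simp only [mul_assoc]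
        _ = aFac u n (i+1) x * aFac u n (i+2) y * (hFac u i x * hFac u (i+1) y * hFac u i y) := by
            rw [c]; simp only [mul_assoc]
        _ = aFac u n (i+1) x * (aFac u n (i+2) y * hFac u (i+1) (y - x)) *
              (hFac u i y * hFac u (i+1) x * hFac u i x) := by
            rw [s4]; simp only [mul_assoc]
        _ = aFac u n (i+1) x * aFac u n (i+1) y * hFac u (i+1) (-x) *
              (hFac u i y * hFac u (i+1) x * hFac u i x) := by
            rw [s2]; simp only [mul_assoc]
        _ = aFac u n (i+1) y * (aFac u n (i+1) x * hFac u (i+1) (-x)) *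
              (hFac u i y * hFac u (i+1) x * hFac u i x) := by
            rw [IH]; simp only [mul_assoc]
        _ = aFac u n (i+1) y * (aFac u n (i+2) x * hFac u i y) * hFac u (i+1) x * hFac u i x := by
            rw [s3]; simp only [mul_assoc]
        _ = aFac u n i y * aFac u n i x := by
            rw [← c, aFac_step u n i hin x, aFac_step u n i hin y, s1 x]; simp only [mul_assoc]
    · rw [aFac_step u n i hin x, aFac_step u n i hin y, aFac_top u n (i+1) h1,
        aFac_top u n (i+1) h1, one_mul, one_mul, hFac_mul hu, hFac_mul hu, add_comm]

/-- The two-factor divided difference identity. -/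
theorem aFac_pair {u : ℕ → E} (hu : NilRel u) (n i : ℕ) (hin : i < n) (x y : R) :
    aFac u n i x * aFac u n (i+1) y - aFac u n i y * aFac u n (i+1) x
      = (x - y) • (aFac u n i x * aFac u n (i+1) y * u i) := by
  have s : ∀ s : R, aFac u n (i+1) s = aFac u n i s * hFac u i (-s) := by
    intro s
    rw [aFac_step u n i hin, mul_assoc, hFac_mul hu, add_neg_cancel, hFac_zero, mul_one]
  have e : hFac u i (-y) * u i = u i := by
    simp [hFac, add_mul, hu.sq]
  rw [s x, s y, ← mul_assoc, ← mul_assoc, aFac_comm hu n _ i rfl y x, mul_assoc _ _ (u i), e,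
    ← mul_sub, ← mul_smul_comm]
  congr 1
  unfold hFac
  module

theorem fullProd_diff {u : ℕ → E} (hu : NilRel u) (n i : ℕ) (h0 : 0 < i) (hin : i < n)
    (y : ℕ → R) :
    fullProd u n y - fullProd u n (y ∘ Equiv.swap i (i+1))
      = (y i - y (i+1)) • (fullProd u n y * u i) := by
  have hsplit : List.range' 1 n =
      List.range' 1 (i-1) ++ (i :: (i+1) :: List.range' (i+2) (n-i-1)) := by
    have h1 : i :: (i+1) :: List.range' (i+2) (n-i-1) = List.range' i (n-i-1+2) := by
      rw [List.range'_succ, List.range'_succ]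
    rw [h1]
    have := List.range'_append_1 (s := 1) (m := i-1) (n := n-i-1+2)
    rw [show 1 + (i-1) = i by omega] at this
    rw [this]; congr 1; omega
  have hP : ((List.range' 1 (i-1)).map (fun b => aFac u n b ((y ∘ Equiv.swap i (i+1)) b))) =
      ((List.range' 1 (i-1)).map (fun b => aFac u n b (y b))) := by
    apply List.map_congr_left
    intro b hb
    rw [List.mem_range'_1] at hb
    rw [Function.comp, Equiv.swap_apply_of_ne_of_ne (by omega) (by omega)]
  have hQ : ((List.range' (i+2) (n-i-1)).map (fun b => aFac u n b ((y ∘ Equiv.swap i (i+1)) b))) =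
      ((List.range' (i+2) (n-i-1)).map (fun b => aFac u n b (y b))) := by
    apply List.map_congr_left
    intro b hb
    rw [List.mem_range'_1] at hb
    rw [Function.comp, Equiv.swap_apply_of_ne_of_ne (by omega) (by omega)]
  have hc : Commute (u i) ((List.range' (i+2) (n-i-1)).map (fun b => aFac u n b (y b))).prod := by
    apply Commute.list_prod_right
    intro z hz
    simp only [List.mem_map, List.mem_range'_1] at hz
    obtain ⟨b, hb, rfl⟩ := hz
    apply aFac_commute_right
    intro c hc
    have : Commute (u i) (u c) := hu.comm i c (by omega)
    exact (Commute.one_right _).add_right (this.smul_right _)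
  have key := aFac_pair hu n i hin (y i) (y (i+1))
  unfold fullProd
  rw [hsplit]
  simp only [List.map_append, List.map_cons, List.prod_append, List.prod_cons]
  rw [hP, hQ]
  generalize ((List.range' (i+2) (n-i-1)).map (fun b => aFac u n b (y b))).prod = Q at *
  generalize ((List.range' 1 (i-1)).map (fun b => aFac u n b (y b))).prod = P at *
  simp only [Function.comp, Equiv.swap_apply_left, Equiv.swap_apply_right]
  have hc' : Q * u i = u i * Q := hc.eq.symm
  calc _ = P * (aFac u n i (y i) * aFac u n (i+1) (y (i+1))
        - aFac u n i (y (i+1)) * aFac u n (i+1) (y i)) * Q := by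
        simp only [mul_assoc, mul_sub, sub_mul]
    _ = _ := by
        rw [key]
        simp only [mul_assoc, hc', mul_smul_comm, smul_mul_assoc]

theorem prod_one_add_sublists {ι : Type*} (g : ι → E) (L : List ι) :
    (L.map (fun p => 1 + g p)).prod = ((L.sublists').map (fun l => (l.map g).prod)).sum := by
  induction L with
  | nil => simp
  | cons a L ih =>
    simp only [List.map_cons, List.prod_cons, ih, List.sublists'_cons, List.map_append,
      List.map_map, List.sum_append, add_mul, one_mul]
    congr 1
    rw [← List.sum_map_mul_left]
    rfl

theorem prod_smul_map {ι : Type*} (c : ι → R) (g : ι → E) (l : List ι) :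
    (l.map (fun p => c p • g p)).prod = (l.map c).prod • (l.map g).prod := by
  induction l with
  | nil => simp
  | cons a l ih =>
    rw [List.map_cons, List.prod_cons, ih, smul_mul_smul_comm]
    rfl

/-- The list of all pairs `(b, a)`, in the order of factors of `fullProd`. -/
def pairList (n : ℕ) : List (ℕ × ℕ) :=
  (List.range' 1 n).flatMap (fun b => (List.range' b (n - b)).reverse.map (fun a => (b, a)))

theorem fullProd_eq (u : ℕ → E) (n : ℕ) (y : ℕ → R) :
    fullProd u n y = (((pairList n).sublists').map
      (fun l => (l.map (fun p => y p.1)).prod • (l.map (fun p => u p.2)).prod)).sum := by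
  have : fullProd u n y = ((pairList n).map (fun p => 1 + y p.1 • u p.2)).prod := by
    unfold fullProd pairList aFac hFac
    induction List.range' 1 n with
    | nil => simp
    | cons b l ih =>
      rw [List.map_cons, List.prod_cons, ih, List.flatMap_cons, List.map_append, List.prod_append,
        List.map_map]
      rfl
  rw [this, prod_one_add_sublists]
  simp only [prod_smul_map]

end BJSAlg
section BJSPerm
variable {n : ℕ}

/-- `w` has a descent at (1-indexed) position `a`. -/
def IsDesc (n a : ℕ) (w : Equiv.Perm (Fin n)) : Prop :=
  ∃ h : 0 < a ∧ a < n, w ⟨a, h.2⟩ < w ⟨a - 1, lt_of_le_of_lt (Nat.sub_le a 1) h.2⟩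

/-- Number of inversions. -/
def invCount (w : Equiv.Perm (Fin n)) : ℕ :=
  (Finset.univ.filter (fun p : Fin n × Fin n => p.1 < p.2 ∧ w p.2 < w p.1)).card

theorem simpleT_of {a : ℕ} (h : 0 < a ∧ a < n) : simpleT n a =
    Equiv.swap ⟨a - 1, lt_of_le_of_lt (Nat.sub_le a 1) h.2⟩ ⟨a, h.2⟩ := by
  simp [simpleT, h]

theorem simpleT_mul_self (a : ℕ) : simpleT n a * simpleT n a = 1 := by
  unfold simpleT
  split_ifs <;> simp

theorem mul_simpleT_simpleT (w : Equiv.Perm (Fin n)) (a : ℕ) :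
    w * simpleT n a * simpleT n a = w := by
  rw [mul_assoc, simpleT_mul_self, mul_one]

theorem isDesc_iff {a : ℕ} (h : 0 < a ∧ a < n) (w : Equiv.Perm (Fin n)) :
    IsDesc n a w ↔ w ⟨a, h.2⟩ < w ⟨a - 1, lt_of_le_of_lt (Nat.sub_le a 1) h.2⟩ :=
  ⟨fun ⟨_, h2⟩ => h2, fun h2 => ⟨h, h2⟩⟩

theorem isDesc_mul_iff {a : ℕ} (h : 0 < a ∧ a < n) (w : Equiv.Perm (Fin n)) :
    IsDesc n a (w * simpleT n a) ↔ ¬ IsDesc n a w := by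
  have hne : w ⟨a, h.2⟩ ≠ w ⟨a - 1, lt_of_le_of_lt (Nat.sub_le a 1) h.2⟩ := by
    intro e
    have := w.injective e
    simp only [Fin.mk.injEq] at this
    omega
  rw [isDesc_iff h, isDesc_iff h]
  simp only [simpleT_of h, Equiv.Perm.mul_apply, Equiv.swap_apply_left, Equiv.swap_apply_right]
  rw [not_lt]
  exact ⟨le_of_lt, fun h1 => lt_of_le_of_ne h1 hne.symm⟩

theorem invCount_mul_of_not_desc {a : ℕ} (h : 0 < a ∧ a < n) (w : Equiv.Perm (Fin n))
    (hd : ¬ IsDesc n a w) : invCount (w * simpleT n a) = invCount w + 1 := by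
  have hlt : w ⟨a - 1, lt_of_le_of_lt (Nat.sub_le a 1) h.2⟩ < w ⟨a, h.2⟩ := by
    have := (isDesc_mul_iff h w).2 hd
    obtain ⟨_, h2⟩ := this
    simpa [simpleT_of h] using h2
  rw [simpleT_of h]
  set i : Fin n := ⟨a - 1, lt_of_le_of_lt (Nat.sub_le a 1) h.2⟩ with hi
  set j : Fin n := ⟨a, h.2⟩ with hj
  have hij : (i : ℕ) + 1 = j := by simp only [hi, hj]; omega
  have hnot : (j, i) ∉ (Finset.univ.filter (fun p : Fin n × Fin n => p.1 < p.2 ∧ w p.2 < w p.1)) := by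
    simp only [Finset.mem_filter, Finset.mem_univ, true_and, not_and, Fin.lt_def]
    omega
  unfold invCount
  rw [← Finset.card_insert_of_notMem hnot]
  apply Finset.card_bij (fun p _ => (Equiv.swap i j p.1, Equiv.swap i j p.2))
  · rintro ⟨p, q⟩ hp
    rw [Finset.mem_filter] at hp
    simp only [Finset.mem_insert, Finset.mem_filter, Finset.mem_univ, true_and, Prod.mk.injEq]
    obtain ⟨-, h1, h2⟩ := hp
    simp only [Equiv.Perm.mul_apply] at h1 h2
    by_cases hpi : p = i ∧ q = j
    · left; simp [hpi]
    · right
      refine ⟨?_, h2⟩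
      simp only [Equiv.swap_apply_def]
      simp only [Fin.lt_def, Fin.ext_iff] at *
      split_ifs <;> omega
  · rintro ⟨p, q⟩ _ ⟨p', q'⟩ _ he
    simpa using he
  · rintro ⟨p, q⟩ hp
    refine ⟨(Equiv.swap i j p, Equiv.swap i j q), ?_, by simp⟩
    simp only [Finset.mem_insert, Finset.mem_filter, Finset.mem_univ, true_and, Prod.mk.injEq] at hp
    rw [Finset.mem_filter]
    refine ⟨Finset.mem_univ _, ?_⟩
    simp only [Equiv.Perm.mul_apply, Equiv.swap_apply_self]
    rcases hp with ⟨rfl, rfl⟩ | ⟨h1, h2⟩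
    · simp only [Equiv.swap_apply_left, Equiv.swap_apply_right, hlt, and_true, Fin.lt_def]
      omega
    · refine ⟨?_, h2⟩
      have hpi : ¬ (p = i ∧ q = j) := by
        rintro ⟨rfl, rfl⟩; exact lt_asymm h2 hlt
      simp only [Equiv.swap_apply_def]
      simp only [Fin.lt_def, Fin.ext_iff] at *
      split_ifs <;> omega

theorem invCount_of_desc {a : ℕ} (w : Equiv.Perm (Fin n))
    (hd : IsDesc n a w) : invCount (w * simpleT n a) + 1 = invCount w := by
  have h := hd.1
  have := invCount_mul_of_not_desc h (w * simpleT n a)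
    (by rw [isDesc_mul_iff h]; exact not_not.mpr hd)
  rw [mul_simpleT_simpleT] at this
  exact this.symm

theorem eq_one_of_no_desc (w : Equiv.Perm (Fin n)) (h : ∀ a, ¬ IsDesc n a w) : w = 1 := by
  have hm : StrictMono w := by
    have key : ∀ k : ℕ, ∀ p q : Fin n, (p : ℕ) + k + 1 = q → w p < w q := by
      intro k
      induction k with
      | zero =>
        intro p q hpq
        have h1 := h q
        simp only [IsDesc, not_exists, not_lt] at h1
        have h2 := h1 ⟨by omega, q.2⟩
        have e : (⟨(q : ℕ) - 1, lt_of_le_of_lt (Nat.sub_le _ 1) q.2⟩ : Fin n) = p := by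
          apply Fin.ext; simp; omega
        rw [e] at h2
        refine lt_of_le_of_ne h2 (fun e => ?_)
        have := w.injective e
        simp only [Fin.ext_iff] at this
        omega
      | succ k ih =>
        intro p q hpq
        have h1 := ih p ⟨(p : ℕ) + k + 1, by omega⟩ rfl
        refine h1.trans ?_
        have h1 := h q
        simp only [IsDesc, not_exists, not_lt] at h1
        have h2 := h1 ⟨by omega, q.2⟩
        have e : (⟨(q : ℕ) - 1, lt_of_le_of_lt (Nat.sub_le _ 1) q.2⟩ : Fin n)
            = ⟨(p : ℕ) + k + 1, by omega⟩ := by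
          apply Fin.ext; simp; omega
        rw [e] at h2
        refine lt_of_le_of_ne h2 (fun e => ?_)
        have := w.injective e
        simp only [Fin.ext_iff] at this
        omega
    intro p q hpq
    exact key (q - p - 1) p q (by simp only [Fin.lt_def] at hpq; omega)
  let e : Fin n ≃o Fin n := StrictMono.orderIsoOfSurjective w hm w.surjective
  have : e = OrderIso.refl _ := Subsingleton.elim _ _
  ext x
  have := congrArg (fun f : Fin n ≃o Fin n => ((f x : Fin n) : ℕ)) this
  simpa [e] using this

theorem exists_asc (w : Equiv.Perm (Fin n)) (h : w ≠ Fin.revPerm) :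
    ∃ a, (0 < a ∧ a < n) ∧ ¬ IsDesc n a w := by
  by_contra hc
  push Not at hc
  apply h
  have : Fin.revPerm * w = 1 := by
    apply eq_one_of_no_desc
    rintro a ⟨ha, h1⟩
    obtain ⟨_, h2⟩ := hc a ha
    simp only [Equiv.Perm.mul_apply, Fin.revPerm_apply, Fin.rev_lt_rev] at h1
    exact lt_asymm h1 h2
  ext x
  have := congrArg (fun f : Equiv.Perm (Fin n) => Fin.rev (f x)) this
  simp only [Equiv.Perm.mul_apply, Fin.revPerm_apply, Fin.rev_rev, Equiv.Perm.one_apply] at this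
  rw [this]; rfl

theorem invCount_one : invCount (1 : Equiv.Perm (Fin n)) = 0 := by
  unfold invCount
  rw [Finset.card_eq_zero, Finset.filter_eq_empty_iff]
  rintro ⟨p, q⟩ _ ⟨h1, h2⟩
  exact lt_asymm h1 h2

theorem invCount_le (w : Equiv.Perm (Fin n)) : invCount w ≤ n * n := by
  unfold invCount
  refine (Finset.card_le_univ _).trans ?_
  simp

theorem wordProd_append (α : List ℕ) (a : ℕ) :
    wordProd n (α ++ [a]) = wordProd n α * simpleT n a := by
  simp [wordProd]

theorem invCount_wordProd_le (α : List ℕ) (hα : ∀ x ∈ α, 0 < x ∧ x < n) :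
    invCount (wordProd n α) ≤ α.length := by
  induction α using List.reverseRecOn with
  | nil => simp [wordProd, invCount_one]
  | append_singleton α a ih =>
    have h1 := ih (fun x hx => hα x (by simp [hx]))
    have ha := hα a (by simp)
    rw [wordProd_append]
    simp only [List.length_append, List.length_singleton]
    by_cases hd : IsDesc n a (wordProd n α)
    · have := invCount_of_desc _ hd; omega
    · have := invCount_mul_of_not_desc ha _ hd; omega

theorem exists_word (k : ℕ) : ∀ w : Equiv.Perm (Fin n), invCount w = k →
    ∃ α : List ℕ, (∀ x ∈ α, 0 < x ∧ x < n) ∧ wordProd n α = w ∧ α.length = k := by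
  induction k with
  | zero =>
    intro w hw
    refine ⟨[], by simp, ?_, rfl⟩
    rw [eq_one_of_no_desc w]
    · rfl
    · intro a ha
      have := invCount_of_desc w ha
      omega
  | succ k ih =>
    intro w hw
    have : ∃ a, IsDesc n a w := by
      by_contra hc
      push Not at hc
      rw [eq_one_of_no_desc w hc, invCount_one] at hw
      omega
    obtain ⟨a, ha⟩ := this
    obtain ⟨α, h1, h2, h3⟩ := ih (w * simpleT n a) (by have := invCount_of_desc w ha; omega)
    refine ⟨α ++ [a], ?_, ?_, by simp [h3]⟩
    · intro x hx
      rw [List.mem_append, List.mem_singleton] at hx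
      rcases hx with hx | rfl
      · exact h1 x hx
      · exact ha.1
    · rw [wordProd_append, h2, mul_simpleT_simpleT]

theorem isRedWord_iff (w : Equiv.Perm (Fin n)) (α : List ℕ) : IsRedWord n w α ↔
    (∀ x ∈ α, 0 < x ∧ x < n) ∧ wordProd n α = w ∧ α.length = invCount w := by
  constructor
  · rintro ⟨h1, h2, h3⟩
    refine ⟨h1, h2, le_antisymm ?_ ?_⟩
    · obtain ⟨γ, g1, g2, g3⟩ := exists_word _ w rfl
      rw [← g3]; exact h3 γ g1 g2
    · rw [← h2]; exact invCount_wordProd_le α h1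
  · rintro ⟨h1, h2, h3⟩
    refine ⟨h1, h2, fun γ g1 g2 => ?_⟩
    rw [h3, ← g2]; exact invCount_wordProd_le γ g1

theorem isRedWord_nil (w : Equiv.Perm (Fin n)) : IsRedWord n w [] ↔ w = 1 := by
  rw [isRedWord_iff]
  constructor
  · rintro ⟨-, h, -⟩; rw [← h]; rfl
  · rintro rfl; simp [wordProd, invCount_one]

theorem isRedWord_append (w : Equiv.Perm (Fin n)) (α : List ℕ) (a : ℕ) :
    IsRedWord n w (α ++ [a]) ↔ IsDesc n a w ∧ IsRedWord n (w * simpleT n a) α := by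
  simp only [isRedWord_iff, wordProd_append, List.length_append, List.length_singleton]
  constructor
  · rintro ⟨h1, h2, h3⟩
    have ha := h1 a (by simp)
    have hα : ∀ x ∈ α, 0 < x ∧ x < n := fun x hx => h1 x (by simp [hx])
    have e : wordProd n α = w * simpleT n a := by rw [← h2, mul_simpleT_simpleT]
    have hle := invCount_wordProd_le α hα
    rw [e] at hle
    by_cases hd : IsDesc n a w
    · have := invCount_of_desc w hd
      exact ⟨hd, hα, e, by omega⟩
    · have := invCount_mul_of_not_desc ha w hd
      omega
  · rintro ⟨hd, h1, h2, h3⟩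
    refine ⟨?_, ?_, ?_⟩
    · intro x hx
      rw [List.mem_append, List.mem_singleton] at hx
      rcases hx with hx | rfl
      · exact h1 x hx
      · exact hd.1
    · rw [h2, mul_simpleT_simpleT]
    · have := invCount_of_desc w hd; omega

/-- Consecutive letters in a reduced word differ. -/
theorem isRedWord_ne (α : List ℕ) : ∀ w : Equiv.Perm (Fin n), IsRedWord n w α →
    List.IsChain (· ≠ ·) α := by
  induction α using List.reverseRecOn with
  | nil => intros; simp
  | append_singleton α a ih =>
    intro w hw
    have h1 := (isRedWord_append w α a).1 hw
    rw [List.isChain_append]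
    refine ⟨ih _ h1.2, by simp, ?_⟩
    intro x hx y hy
    simp only [List.head?_cons, Option.mem_def, Option.some.injEq] at hy
    subst hy
    rintro rfl
    obtain ⟨α', rfl⟩ : ∃ α', α = α' ++ [x] := by
      rw [Option.mem_def, List.getLast?_eq_some_iff] at hx
      exact hx
    have h2 := ((isRedWord_append _ α' x).1 h1.2).1
    rw [isDesc_mul_iff h1.1.1] at h2
    exact h2 h1.1

theorem invCount_rev : invCount (Fin.revPerm : Equiv.Perm (Fin n)) = ∑ i : Fin n, (n - 1 - (i : ℕ)) := by
  unfold invCount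
  have : (Finset.univ.filter (fun p : Fin n × Fin n => p.1 < p.2 ∧
      (Fin.revPerm : Equiv.Perm (Fin n)) p.2 < (Fin.revPerm : Equiv.Perm (Fin n)) p.1))
      = Finset.univ.filter (fun p : Fin n × Fin n => p.1 < p.2) := by
    ext p; simp
  rw [this, Finset.card_filter, Fintype.sum_prod_type]
  apply Finset.sum_congr rfl
  intro i _
  rw [← Finset.card_filter, ← Fin.card_Ioi]
  congr 1
  ext x; simp

end BJSPerm
section BJSOp
variable {n : ℕ} {R : Type*} [CommRing R]

open Classical in
/-- Right multiplication by the nilCoxeter generator `u_a`, on coefficient functions. -/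
noncomputable def uOp (n : ℕ) (R : Type*) [CommRing R] (a : ℕ) :
    Module.End R (Equiv.Perm (Fin n) → R) where
  toFun f := fun w => if IsDesc n a w then f (w * simpleT n a) else 0
  map_add' f g := by
    funext w
    simp only [Pi.add_apply]
    split_ifs <;> simp
  map_smul' c f := by
    funext w
    simp only [Pi.smul_apply, RingHom.id_apply]
    split_ifs <;> simp

open Classical in
theorem uOp_apply (a : ℕ) (f : Equiv.Perm (Fin n) → R) (w : Equiv.Perm (Fin n)) :
    uOp n R a f w = if IsDesc n a w then f (w * simpleT n a) else 0 := rfl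

theorem uOp_sq (a : ℕ) : uOp n R a * uOp n R a = 0 := by
  refine LinearMap.ext fun f => ?_
  funext w
  rw [Module.End.mul_apply, uOp_apply, uOp_apply]
  by_cases h : IsDesc n a w
  · have : ¬ IsDesc n a (w * simpleT n a) := by
      rw [isDesc_mul_iff h.1]; exact not_not.mpr h
    simp [this]
  · simp [h]

theorem uOp_comm (a b : ℕ) (hab : a + 2 ≤ b) :
    uOp n R a * uOp n R b = uOp n R b * uOp n R a := by
  refine LinearMap.ext fun f => ?_
  funext w
  simp only [Module.End.mul_apply, uOp_apply]
  by_cases ha : 0 < a ∧ a < n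
  swap
  · have : ∀ v, ¬ IsDesc n a v := fun v h => ha h.1
    simp [this]
  by_cases hb : 0 < b ∧ b < n
  swap
  · have : ∀ v, ¬ IsDesc n b v := fun v h => hb h.1
    simp [this]
  simp only [isDesc_iff ha, isDesc_iff hb, simpleT_of ha, simpleT_of hb, Equiv.Perm.mul_apply]
  have n1 : (⟨a, ha.2⟩ : Fin n) ≠ ⟨b, hb.2⟩ := by
    simp only [ne_eq, Fin.ext_iff]; omega
  have n2 : (⟨a, ha.2⟩ : Fin n) ≠ ⟨b - 1, lt_of_le_of_lt (Nat.sub_le b 1) hb.2⟩ := by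
    simp only [ne_eq, Fin.ext_iff]; omega
  have n3 : (⟨a - 1, lt_of_le_of_lt (Nat.sub_le a 1) ha.2⟩ : Fin n) ≠ ⟨b, hb.2⟩ := by
    simp only [ne_eq, Fin.ext_iff]; omega
  have n4 : (⟨a - 1, lt_of_le_of_lt (Nat.sub_le a 1) ha.2⟩ : Fin n) ≠
      ⟨b - 1, lt_of_le_of_lt (Nat.sub_le b 1) hb.2⟩ := by
    simp only [ne_eq, Fin.ext_iff]; omega
  rw [Equiv.swap_apply_of_ne_of_ne n3.symm n1.symm, Equiv.swap_apply_of_ne_of_ne n4.symm n2.symm,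
    Equiv.swap_apply_of_ne_of_ne n2 n1, Equiv.swap_apply_of_ne_of_ne n4 n3]
  generalize (⟨a, ha.2⟩ : Fin n) = p at *
  generalize (⟨a - 1, lt_of_le_of_lt (Nat.sub_le a 1) ha.2⟩ : Fin n) = p' at *
  generalize (⟨b, hb.2⟩ : Fin n) = q at *
  generalize (⟨b - 1, lt_of_le_of_lt (Nat.sub_le b 1) hb.2⟩ : Fin n) = q' at *
  have e : Equiv.swap p' p * Equiv.swap q' q = Equiv.swap q' q * Equiv.swap p' p := by
    ext x
    simp only [Equiv.Perm.mul_apply, Equiv.swap_apply_def]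
    split_ifs <;> simp_all
  rw [mul_assoc, e, ← mul_assoc]
  split_ifs <;> rfl

theorem uOp_braid (a : ℕ) :
    uOp n R a * uOp n R (a+1) * uOp n R a = uOp n R (a+1) * uOp n R a * uOp n R (a+1) := by
  refine LinearMap.ext fun f => ?_
  funext w
  simp only [Module.End.mul_apply, uOp_apply]
  by_cases ha : 0 < a ∧ a < n
  swap
  · have : ∀ v, ¬ IsDesc n a v := fun v h => ha h.1
    simp [this]
  by_cases hb : 0 < a + 1 ∧ a + 1 < n
  swap
  · have : ∀ v, ¬ IsDesc n (a+1) v := fun v h => hb h.1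
    simp [this]
  simp only [isDesc_iff ha, isDesc_iff hb, simpleT_of ha, simpleT_of hb, Equiv.Perm.mul_apply,
    Nat.add_sub_cancel]
  have n1 : (⟨a - 1, lt_of_le_of_lt (Nat.sub_le a 1) ha.2⟩ : Fin n) ≠ ⟨a, ha.2⟩ := by
    simp only [ne_eq, Fin.ext_iff]; omega
  have n2 : (⟨a, ha.2⟩ : Fin n) ≠ ⟨a + 1, hb.2⟩ := by
    simp only [ne_eq, Fin.ext_iff]; omega
  have n3 : (⟨a - 1, lt_of_le_of_lt (Nat.sub_le a 1) ha.2⟩ : Fin n) ≠ ⟨a + 1, hb.2⟩ := by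
    simp only [ne_eq, Fin.ext_iff]; omega
  generalize (⟨a - 1, lt_of_le_of_lt (Nat.sub_le a 1) ha.2⟩ : Fin n) = p at *
  generalize (⟨a, ha.2⟩ : Fin n) = q at *
  generalize (⟨a + 1, hb.2⟩ : Fin n) = r at *
  have e : Equiv.swap p q * Equiv.swap q r * Equiv.swap p q
      = Equiv.swap q r * Equiv.swap p q * Equiv.swap q r := by
    ext x
    simp only [Equiv.Perm.mul_apply, Equiv.swap_apply_def]
    split_ifs <;> simp_all
  have e' : w * Equiv.swap p q * Equiv.swap q r * Equiv.swap p q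
      = w * Equiv.swap q r * Equiv.swap p q * Equiv.swap q r := by
    simp only [mul_assoc] at e ⊢
    rw [e]
  rw [e']
  simp only [Equiv.swap_apply_left, Equiv.swap_apply_right,
    Equiv.swap_apply_of_ne_of_ne n3.symm n2.symm, Equiv.swap_apply_of_ne_of_ne n1 n3]
  split_ifs <;> rfl

/-- The generators in the opposite endomorphism algebra. -/
noncomputable def uGen (n : ℕ) (R : Type*) [CommRing R] (a : ℕ) :
    (Module.End R (Equiv.Perm (Fin n) → R))ᵐᵒᵖ := MulOpposite.op (uOp n R a)

theorem uGen_rel : NilRel (uGen n R) where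
  sq a := by
    unfold uGen
    rw [← MulOpposite.op_mul, uOp_sq, MulOpposite.op_zero]
  braid a := by
    unfold uGen
    simp only [← MulOpposite.op_mul]
    rw [← mul_assoc, uOp_braid, ← mul_assoc]
  comm a b hab := by
    unfold uGen
    simp only [← MulOpposite.op_mul]
    rw [uOp_comm a b hab]

/-- The coefficient of `w` in an element acting on the identity. -/
noncomputable def coeffAt (e : (Module.End R (Equiv.Perm (Fin n) → R))ᵐᵒᵖ)
    (w : Equiv.Perm (Fin n)) : R :=
  e.unop (Pi.single 1 1) w

/-- `coeffAt` as a linear map. -/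
noncomputable def coeffLin (w : Equiv.Perm (Fin n)) :
    (Module.End R (Equiv.Perm (Fin n) → R))ᵐᵒᵖ →ₗ[R] R where
  toFun e := coeffAt e w
  map_add' e f := by simp [coeffAt]
  map_smul' c f := by simp [coeffAt]

theorem coeffAt_mul_uGen_of_desc (e : (Module.End R (Equiv.Perm (Fin n) → R))ᵐᵒᵖ)
    (w : Equiv.Perm (Fin n)) (a : ℕ) (h : IsDesc n a w) :
    coeffLin w (e * uGen n R a) = coeffLin (w * simpleT n a) e := by
  simp [coeffLin, coeffAt, uGen, uOp_apply, h]

open Classical in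
theorem coeffLin_word (α : List ℕ) : ∀ w : Equiv.Perm (Fin n),
    coeffLin w ((α.map (uGen n R)).prod) = if IsRedWord n w α then 1 else 0 := by
  induction α using List.reverseRecOn with
  | nil =>
    intro w
    rw [isRedWord_nil]
    simp [coeffLin, coeffAt, Pi.single_apply]
  | append_singleton α a ih =>
    intro w
    rw [isRedWord_append, List.map_append, List.prod_append, List.map_singleton,
      List.prod_singleton]
    by_cases h : IsDesc n a w
    · rw [coeffAt_mul_uGen_of_desc _ _ _ h, ih]
      simp [h]
    · simp [coeffLin, coeffAt, uGen, uOp_apply, h]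

/-- The BJS sum, with variables specialised to `y`. -/
noncomputable def bjsT (y : ℕ → R) (w : Equiv.Perm (Fin n)) : R :=
  coeffLin w (fullProd (uGen n R) n y)

open Classical in
theorem bjsT_eq (y : ℕ → R) (w : Equiv.Perm (Fin n)) :
    bjsT y w = (((pairList n).sublists').map (fun l =>
      if IsRedWord n w (l.map Prod.snd) then (l.map (fun p => y p.1)).prod else 0)).sum := by
  unfold bjsT
  rw [fullProd_eq, map_list_sum, List.map_map]
  congr 1
  apply List.map_congr_left
  intro l _
  have := coeffLin_word (R := R) (l.map Prod.snd) w
  rw [List.map_map] at this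
  rw [Function.comp_apply, map_smul]
  have e : (List.map (fun p => uGen n R p.2) l) = List.map (uGen n R ∘ Prod.snd) l := rfl
  rw [e, this]
  simp

theorem bjsT_map {R' : Type*} [CommRing R'] (φ : R →+* R') (y : ℕ → R) (w : Equiv.Perm (Fin n)) :
    φ (bjsT y w) = bjsT (φ ∘ y) w := by
  rw [bjsT_eq, bjsT_eq, map_list_sum, List.map_map]
  congr 1
  apply List.map_congr_left
  intro l _
  rw [Function.comp_apply, apply_ite φ, map_zero, map_list_prod, List.map_map]
  rfl

theorem bjsT_diff (y : ℕ → R) (w : Equiv.Perm (Fin n)) (a : ℕ) (h : IsDesc n a w) :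
    (y a - y (a+1)) * bjsT y (w * simpleT n a)
      = bjsT y w - bjsT (y ∘ Equiv.swap a (a+1)) w := by
  have := congrArg (coeffLin w) (fullProd_diff (uGen_rel (n := n) (R := R)) n a h.1.1 h.1.2 y)
  rw [map_sub, map_smul, coeffAt_mul_uGen_of_desc _ _ _ h] at this
  exact this.symm

theorem bjsT_one (y : ℕ → R) : bjsT y (1 : Equiv.Perm (Fin n)) = 1 := by
  classical
  rw [bjsT_eq]
  have : ∀ l : List (ℕ × ℕ), IsRedWord n 1 (l.map Prod.snd) ↔ l = [] := by
    intro l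
    rw [isRedWord_iff, invCount_one]
    constructor
    · rintro ⟨-, -, h⟩; simpa using h
    · rintro rfl; simp [wordProd]
  simp only [this]
  induction pairList n with
  | nil => simp
  | cons a L ih =>
    rw [List.sublists'_cons, List.map_append, List.sum_append, ih, List.map_map]
    have : ∀ L' : List (List (ℕ × ℕ)), (L'.map ((fun l => if l = [] then
        (l.map (fun p => y p.1)).prod else 0) ∘ List.cons a)).sum = 0 := by
      intro L'
      apply List.sum_eq_zero
      intro x hx
      simp at hx
      exact hx.2.symm
    rw [this, add_zero]

theorem pairList_length (n : ℕ) : (pairList n).length = ∑ i : Fin n, (n - 1 - (i : ℕ)) := by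
  rw [Fin.sum_univ_eq_sum_range (fun i => n - 1 - i) n, Finset.sum_range]
  unfold pairList
  rw [List.length_flatMap, List.range'_eq_map_range, List.map_map, ← List.sum_ofFn]
  congr 1
  apply List.ext_getElem
  · simp
  · intro i h1 h2
    simp
    omega

theorem pairList_prod (n : ℕ) (y : ℕ → R) : ((pairList n).map (fun p => y p.1)).prod
    = ∏ i : Fin n, y ((i : ℕ) + 1) ^ (n - 1 - (i : ℕ)) := by
  unfold pairList
  rw [List.map_flatMap, List.flatMap_def, List.prod_flatten, List.map_map, List.range'_eq_map_range,
    List.map_map, ← List.prod_ofFn]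
  congr 1
  apply List.ext_getElem
  · simp
  · intro i h1 h2
    simp [Function.comp_def]
    rw [add_comm 1 i, Nat.sub_sub, add_comm 1 i]

theorem pairList_mem (n : ℕ) (p : ℕ × ℕ) :
    p ∈ pairList n ↔ 0 < p.1 ∧ p.1 ≤ p.2 ∧ p.2 < n := by
  obtain ⟨b, a⟩ := p
  unfold pairList
  simp only [List.mem_flatMap, List.mem_range'_1, List.mem_map, List.mem_reverse, Prod.mk.injEq]
  constructor
  · rintro ⟨c, hc, d, hd, rfl, rfl⟩
    omega
  · intro h
    exact ⟨b, by omega, a, by omega, rfl, rfl⟩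

/-- The strict order on pairs. -/
def pairLt (p q : ℕ × ℕ) : Prop := p.1 < q.1 ∨ (p.1 = q.1 ∧ q.2 < p.2)

instance : IsTrans (ℕ × ℕ) pairLt := ⟨by
  rintro ⟨a, b⟩ ⟨c, d⟩ ⟨e, f⟩
  simp only [pairLt]
  omega⟩

theorem pairList_sorted (n : ℕ) : (pairList n).Pairwise pairLt := by
  unfold pairList
  rw [List.pairwise_flatMap]
  constructor
  · intro b _
    rw [List.pairwise_map, List.pairwise_reverse]
    refine List.Pairwise.imp ?_ (List.pairwise_lt_range' (s := b) (n := n - b))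
    intro x y h
    exact Or.inr ⟨rfl, h⟩
  · refine List.Pairwise.imp ?_ (List.pairwise_lt_range' (s := 1) (n := n))
    intro x y h p hp q hq
    simp only [List.mem_map] at hp hq
    obtain ⟨_, _, rfl⟩ := hp
    obtain ⟨_, _, rfl⟩ := hq
    exact Or.inl h

theorem pairLt_irrefl (p : ℕ × ℕ) : ¬ pairLt p p := by simp [pairLt]

theorem pairLt_nodup (l : List (ℕ × ℕ)) (h : l.Pairwise pairLt) : l.Nodup := by
  refine List.Pairwise.imp ?_ h
  rintro a b hab rfl
  exact pairLt_irrefl a hab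

theorem sublist_pairList_iff (n : ℕ) (l : List (ℕ × ℕ)) :
    l.Sublist (pairList n) ↔ l.Pairwise pairLt ∧ ∀ p ∈ l, p ∈ pairList n := by
  constructor
  · intro h
    exact ⟨(pairList_sorted n).sublist h, fun p hp => h.subset hp⟩
  · rintro ⟨h1, h2⟩
    have hs : l.Subperm (pairList n) := (pairLt_nodup l h1).subperm (fun p hp => h2 p hp)
    have : Std.Antisymm pairLt := ⟨by
      rintro ⟨a, b⟩ ⟨c, d⟩
      simp only [pairLt, Prod.mk.injEq]
      omega⟩
    exact List.sublist_of_subperm_of_pairwise hs h1 (pairList_sorted n)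

theorem bjsT_rev (y : ℕ → R) (h : bjsT y (Fin.revPerm : Equiv.Perm (Fin n)) ≠ 0) :
    bjsT y (Fin.revPerm : Equiv.Perm (Fin n)) = ∏ i : Fin n, y ((i : ℕ) + 1) ^ (n - 1 - (i : ℕ)) := by
  classical
  have key : ∀ l : List (ℕ × ℕ), l.Sublist (pairList n) →
      IsRedWord n Fin.revPerm (l.map Prod.snd) → l = pairList n := by
    intro l hl hr
    apply hl.eq_of_length
    have := ((isRedWord_iff _ _).1 hr).2.2
    rw [List.length_map] at this
    rw [this, invCount_rev, pairList_length]
  by_cases hP : IsRedWord n Fin.revPerm ((pairList n).map Prod.snd)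
  · rw [bjsT_eq, ← pairList_prod]
    have nd := List.nodup_sublists'.2 (pairLt_nodup _ (pairList_sorted n))
    rw [← List.sum_toFinset _ nd, Finset.sum_eq_single (pairList n)]
    · rw [if_pos hP]
    · intro l hl hne
      rw [if_neg]
      intro hr
      exact hne (key l (by simpa using hl) hr)
    · intro hn
      exact absurd (by simp) hn
  · exfalso
    apply h
    rw [bjsT_eq]
    apply List.sum_eq_zero
    intro x hx
    rw [List.mem_map] at hx
    obtain ⟨l, hl, rfl⟩ := hx
    rw [if_neg]
    intro hr
    rw [List.mem_sublists'] at hl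
    rw [key l hl hr] at hr
    exact hP hr

end BJSOp
section BJSFinal
variable {n : ℕ}

theorem weak_induction (P : Equiv.Perm (Fin n) → Prop) (h0 : P Fin.revPerm)
    (hs : ∀ w a, (0 < a ∧ a < n) → ¬ IsDesc n a w → P (w * simpleT n a) → P w) :
    ∀ w, P w := by
  have key : ∀ k : ℕ, ∀ w : Equiv.Perm (Fin n), n * n - invCount w = k → P w := by
    intro k
    induction k using Nat.strong_induction_on with
    | _ k ih =>
      intro w hw
      by_cases hr : w = Fin.revPerm
      · rw [hr]; exact h0
      · obtain ⟨a, ha, hd⟩ := exists_asc w hr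
        have h1 := invCount_mul_of_not_desc ha w hd
        have h2 := invCount_le (w * simpleT n a)
        exact hs w a ha hd (ih _ (by omega) _ rfl)
  exact fun w => key _ w rfl

theorem bjsT_rec (w : Equiv.Perm (Fin n)) (a : ℕ) (ha : 0 < a ∧ a < n) (hd : ¬ IsDesc n a w) :
    (X a - X (a+1) : MvPolynomial ℕ ℤ) * bjsT X w = bjsT X (w * simpleT n a) -
      rename (Equiv.swap a (a+1)) (bjsT X (w * simpleT n a) : MvPolynomial ℕ ℤ) := by
  have h := bjsT_diff (X : ℕ → MvPolynomial ℕ ℤ) (w * simpleT n a) a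
    ((isDesc_mul_iff ha w).2 hd)
  rw [mul_simpleT_simpleT] at h
  rw [h]
  congr 1
  have := bjsT_map (n := n) (rename (R := ℤ) (Equiv.swap a (a+1))).toRingHom
    (X : ℕ → MvPolynomial ℕ ℤ) (w * simpleT n a)
  have e : (⇑(rename (R := ℤ) (Equiv.swap a (a+1))).toRingHom ∘ (X : ℕ → MvPolynomial ℕ ℤ))
      = X ∘ Equiv.swap a (a+1) := by
    funext b
    simp
  rw [e] at this
  exact this.symm

theorem X_sub_ne (a : ℕ) : (X a - X (a+1) : MvPolynomial ℕ ℤ) ≠ 0 := by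
  rw [sub_ne_zero]
  intro h
  have := X_injective h
  omega

theorem schubert_rec (S : Equiv.Perm (Fin n) → MvPolynomial ℕ ℤ) (hS : SchubertFamily n S)
    (w : Equiv.Perm (Fin n)) (a : ℕ) (ha : 0 < a ∧ a < n) (hd : ¬ IsDesc n a w) :
    (X a - X (a+1) : MvPolynomial ℕ ℤ) * S w = S (w * simpleT n a) -
      rename (Equiv.swap a (a+1)) (S (w * simpleT n a)) := by
  obtain ⟨b, rfl⟩ : ∃ b, a = b + 1 := ⟨a - 1, by omega⟩
  have hlt : w ⟨b, by omega⟩ < w ⟨b + 1, ha.2⟩ := by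
    obtain ⟨_, h2⟩ := (isDesc_mul_iff ha w).2 hd
    simpa [simpleT_of ha] using h2
  have := hS.2 w ⟨b, by omega⟩ ha.2 hlt
  rw [simpleT_of ha]
  exact this

theorem schubert_eq_bjsT (S : Equiv.Perm (Fin n) → MvPolynomial ℕ ℤ) (hS : SchubertFamily n S)
    (w : Equiv.Perm (Fin n)) : S w = bjsT X w := by
  have hne : (bjsT X (Fin.revPerm : Equiv.Perm (Fin n)) : MvPolynomial ℕ ℤ) ≠ 0 := by
    intro h0
    have := weak_induction (n := n) (fun w => (bjsT X w : MvPolynomial ℕ ℤ) = 0) h0 (by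
      intro w a ha hd h
      have h1 := bjsT_rec w a ha hd
      rw [h, map_zero, sub_zero] at h1
      exact (mul_eq_zero.1 h1).resolve_left (X_sub_ne a)) 1
    rw [bjsT_one] at this
    exact one_ne_zero this
  refine weak_induction (n := n) (fun w => S w = bjsT X w) ?_ ?_ w
  · rw [hS.1, bjsT_rev _ hne]
  · intro w a ha hd h
    have h1 := bjsT_rec w a ha hd
    have h2 := schubert_rec S hS w a ha hd
    rw [h, ← h1] at h2
    exact mul_left_cancel₀ (X_sub_ne a) h2

theorem compat_iff (w : Equiv.Perm (Fin n)) (l : List (ℕ × ℕ))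
    (hr : IsRedWord n w (l.map Prod.snd)) :
    IsCompatible (l.map Prod.fst) (l.map Prod.snd) ↔ l.Sublist (pairList n) := by
  have hne := isRedWord_ne _ _ hr
  have hrange := hr.1
  rw [sublist_pairList_iff, ← List.isChain_iff_pairwise]
  simp only [pairList_mem]
  unfold IsCompatible
  have hch : List.Chain' (· ≤ ·) (l.map Prod.fst) ↔ List.IsChain (· ≤ ·) (l.map Prod.fst) := Iff.rfl
  rw [hch]
  rw [List.isChain_iff_getElem] at hne ⊢
  rw [List.isChain_iff_getElem]
  simp only [List.length_map, List.getElem_map] at hne ⊢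
  constructor
  · rintro ⟨-, h1, h2, h3, h4⟩
    constructor
    · intro i hi
      have a1 := h2 i hi
      have a2 := h4 i hi
      have a3 := hne i hi
      simp only [List.getD_eq_getElem?_getD, List.getElem?_map,
        List.getElem?_eq_getElem hi, List.getElem?_eq_getElem (Nat.lt_of_succ_lt hi),
        Option.map_some, Option.getD_some] at a2
      unfold pairLt
      omega
    · intro p hp
      obtain ⟨i, hi, rfl⟩ := List.getElem_of_mem hp
      have a3 := h3 i hi
      simp only [List.getD_eq_getElem?_getD, List.getElem?_map,
        List.getElem?_eq_getElem hi, Option.map_some, Option.getD_some] at a3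
      exact ⟨h1 _ (List.mem_map_of_mem hp), a3, (hrange _ (List.mem_map_of_mem hp)).2⟩
  · rintro ⟨h1, h2⟩
    refine ⟨trivial, ?_, ?_, ?_, ?_⟩
    · intro x hx
      obtain ⟨p, hp, rfl⟩ := List.mem_map.1 hx
      exact (h2 p hp).1
    · intro i hi
      have := h1 i hi
      unfold pairLt at this
      omega
    · intro i hi
      simp only [List.getD_eq_getElem?_getD, List.getElem?_map,
        List.getElem?_eq_getElem hi, Option.map_some, Option.getD_some]
      exact (h2 _ (List.getElem_mem hi)).2.1
    · intro i hi
      have := h1 i hi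
      unfold pairLt at this
      simp only [List.getD_eq_getElem?_getD, List.getElem?_map,
        List.getElem?_eq_getElem hi, List.getElem?_eq_getElem (Nat.lt_of_succ_lt hi),
        Option.map_some, Option.getD_some]
      omega

theorem bjsT_finsum (w : Equiv.Perm (Fin n)) :
    bjsT X w = ∑ᶠ (α : List ℕ) (_ : IsRedWord n w α),
            ∑ᶠ (β : List ℕ) (_ : IsCompatible β α),
              (β.map (fun b => (X b : MvPolynomial ℕ ℤ))).prod := by
  classical
  let g : List ℕ × List ℕ → MvPolynomial ℕ ℤ := fun q =>
    if IsRedWord n w q.1 ∧ IsCompatible q.2 q.1 then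
      (q.2.map (fun b => (X b : MvPolynomial ℕ ℤ))).prod else 0
  let φ : List (ℕ × ℕ) → List ℕ × List ℕ := fun l => (l.map Prod.snd, l.map Prod.fst)
  let F := (pairList n).sublists'.toFinset.filter (fun l => IsRedWord n w (l.map Prod.snd))
  have hφ : Function.Injective φ := by
    intro l l' h
    simp only [φ, Prod.mk.injEq] at h
    have e : ∀ l : List (ℕ × ℕ), l = (l.map Prod.fst).zip (l.map Prod.snd) := by
      intro l
      induction l with
      | nil => rfl
      | cons a l ih => simpa using ih
    rw [e l, e l', h.1, h.2]
  have hsupp : Function.support g ⊆ (F.image φ : Finset _) := by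
    rintro ⟨α, β⟩ hq
    have hq' : IsRedWord n w α ∧ IsCompatible β α := by
      by_contra hc
      exact hq (if_neg hc)
    obtain ⟨h1, h2⟩ := hq'
    have e1 : (β.zip α).map Prod.snd = α := List.map_snd_zip (by rw [h2.1])
    have e2 : (β.zip α).map Prod.fst = β := List.map_fst_zip (by rw [h2.1])
    rw [Finset.mem_coe, Finset.mem_image]
    refine ⟨β.zip α, ?_, by simp only [φ, e1, e2]⟩
    simp only [F, Finset.mem_filter, List.mem_toFinset, List.mem_sublists', e1]
    refine ⟨?_, h1⟩
    rw [← compat_iff w _ (by rw [e1]; exact h1), e1, e2]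
    exact h2
  have hR : (∑ᶠ (α : List ℕ) (_ : IsRedWord n w α), ∑ᶠ (β : List ℕ) (_ : IsCompatible β α),
      (β.map (fun b => (X b : MvPolynomial ℕ ℤ))).prod) = ∑ᶠ q, g q := by
    rw [finsum_curry g ((F.image φ).finite_toSet.subset hsupp)]
    apply finsum_congr
    intro α
    by_cases h : IsRedWord n w α
    · simp only [h, finsum_true, g, true_and]
      apply finsum_congr
      intro β
      by_cases h' : IsCompatible β α <;> simp [h']
    · simp [h, g]
  rw [hR, finsum_eq_sum_of_support_subset g hsupp, Finset.sum_image hφ.injOn, bjsT_eq,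
    ← List.sum_toFinset _ (List.nodup_sublists'.2 (pairLt_nodup _ (pairList_sorted n))),
    ← Finset.sum_filter]
  apply Finset.sum_congr rfl
  intro l hl
  simp only [F, Finset.mem_filter, List.mem_toFinset, List.mem_sublists'] at hl
  have := (compat_iff w l hl.2).2 hl.1
  simp only [g, φ, hl.2, this, and_self, if_true, List.map_map]
  rfl

end BJSFinal

/-- **The Billey–Jockusch–Stanley formula**: for every permutation `π`,
`𝔖_π = ∑_{α ∈ Red(π)} ∑_{β ⟲ α} ∏_i x_{β_i}`. -/
theorem billey_jockusch_stanley (n : ℕ)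
    (S : Equiv.Perm (Fin n) → MvPolynomial ℕ ℤ) (hS : SchubertFamily n S)
    (π : Equiv.Perm (Fin n)) :
    S π = ∑ᶠ (α : List ℕ) (_ : IsRedWord n π α),
            ∑ᶠ (β : List ℕ) (_ : IsCompatible β α),
              (β.map (fun b => (X b : MvPolynomial ℕ ℤ))).prod := by
  rw [schubert_eq_bjsT S hS π, bjsT_finsum]
end
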